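/- arXiv:1707.04411 — 2 statements merged into one kernel-verified Lean document; each statement's English description precedes it below -/
import Mathlib

section
/- Let d ≥ 1 and let U = {u_1, …, u_k} be a finite set of non-zero vectors in ℤ^d that generate ℤ^d as a group. Let Z_0 = {0,u_1} + {0,u_2} + ⋯ + {0,u_k} (Minkowski sum in ℤ^d) and let Z be the convex hull of Z_0 in ℝ^d. Then for every δ > 0 there exists n_0 such that for every n ≥ n_0 and every finite set S ⊆ ℤ^d with |S| = n, the edge boundary satisfies ∂(S) ≥ (1−δ) d vol(Z)^{1/d} n^{1−1/d}. -/
open Pointwise MeasureTheory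

/-- Edge boundary of a finite set `S ⊆ ℤ^d` in the Cayley graph generated by `u`. -/
def edgeBdry {d k : ℕ} (u : Fin k → (Fin d → ℤ)) (S : Finset (Fin d → ℤ)) : ℕ :=
  ∑ i, (S.filter (fun v => v + u i ∉ S)).card

/-- Embedding of `ℤ^d` into `ℝ^d`. -/
def toReal' {d : ℕ} (v : Fin d → ℤ) : Fin d → ℝ := fun j => (v j : ℝ)


open scoped ENNReal

section PrekopaLeindler

variable {a b : ℝ}

/-- One-dimensional Brunn–Minkowski inequality for compact sets. -/
theorem volume_add_le_of_isCompact (ha : 0 < a) (hb : 0 < b) {K L C : Set ℝ}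
    (hK : IsCompact K) (hL : IsCompact L) (hKne : K.Nonempty) (hLne : L.Nonempty)
    (hC : ∀ x ∈ K, ∀ y ∈ L, a * x + b * y ∈ C) :
    ENNReal.ofReal a * volume K + ENNReal.ofReal b * volume L ≤ volume C := by
  obtain ⟨x₀, hx₀, hmax⟩ := hK.exists_isGreatest hKne
  obtain ⟨y₀, hy₀, hmin⟩ := hL.exists_isLeast hLne
  set p := a * x₀ + b * y₀ with hp
  have h1 : ENNReal.ofReal a * volume K ≤ volume (C ∩ Set.Iic p) := by
    have : volume ((fun x => b * y₀ + x) '' (a • K)) = ENNReal.ofReal a * volume K := by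
      rw [Set.image_add_left, measure_preimage_add, Measure.addHaar_smul]
      simp [abs_of_pos ha]
    rw [← this]
    apply measure_mono
    rintro _ ⟨_, ⟨x, hx, rfl⟩, rfl⟩
    refine ⟨?_, ?_⟩
    · have := hC x hx y₀ hy₀
      simpa [add_comm] using this
    · have := mul_le_mul_of_nonneg_left (hmax hx) ha.le
      simp only [smul_eq_mul, Set.mem_Iic, hp]
      linarith
  have h2 : ENNReal.ofReal b * volume L ≤ volume (C ∩ Set.Ici p) := by
    have : volume ((fun x => a * x₀ + x) '' (b • L)) = ENNReal.ofReal b * volume L := by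
      rw [Set.image_add_left, measure_preimage_add, Measure.addHaar_smul]
      simp [abs_of_pos hb]
    rw [← this]
    apply measure_mono
    rintro _ ⟨_, ⟨y, hy, rfl⟩, rfl⟩
    refine ⟨hC x₀ hx₀ y hy, ?_⟩
    have := mul_le_mul_of_nonneg_left (hmin hy) hb.le
    simp only [smul_eq_mul, Set.mem_Ici, hp]
    linarith
  have h3 : volume (C ∩ Set.Ici p) = volume (C \ Set.Iic p) := by
    apply measure_congr
    rw [Set.sdiff_eq, Set.compl_Iic]
    exact (ae_eq_refl C).inter Ioi_ae_eq_Ici.symm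
  rw [← measure_inter_add_sdiff C (measurableSet_Iic (a := p)), ← h3]
  exact add_le_add h1 h2

/-- One-dimensional Brunn–Minkowski inequality. -/
theorem volume_add_le_of_measurableSet (ha : 0 < a) (hb : 0 < b) {A B C : Set ℝ}
    (hA : MeasurableSet A) (hB : MeasurableSet B) (hAne : A.Nonempty) (hBne : B.Nonempty)
    (hC : ∀ x ∈ A, ∀ y ∈ B, a * x + b * y ∈ C) :
    ENNReal.ofReal a * volume A + ENNReal.ofReal b * volume B ≤ volume C := by
  obtain ⟨x₀, hx₀⟩ := hAne
  obtain ⟨y₀, hy₀⟩ := hBne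
  rw [hA.measure_eq_iSup_isCompact, hB.measure_eq_iSup_isCompact]
  simp only [ENNReal.mul_iSup, iSup_and']
  refine ENNReal.biSup_add_biSup_le' ⟨∅, by simp⟩ ⟨∅, by simp⟩ ?_
  rintro K ⟨hKA, hK⟩ L ⟨hLB, hL⟩
  refine le_trans (add_le_add (mul_le_mul_right (measure_mono (Set.subset_insert x₀ K)) _)
    (mul_le_mul_right (measure_mono (Set.subset_insert y₀ L)) _))
    (volume_add_le_of_isCompact ha hb (hK.insert x₀) (hL.insert y₀) ⟨x₀, by simp⟩
      ⟨y₀, by simp⟩ fun x hx y hy => hC x (Set.insert_subset hx₀ hKA hx) y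
        (Set.insert_subset hy₀ hLB hy))

/-- Prékopa–Leindler inequality on the line for functions of supremum `1`. -/
theorem prekopaLeindler_real_of_iSup_eq_one (ha : 0 < a) (hb : 0 < b) (hab : a + b = 1)
    {f g h : ℝ → ℝ≥0∞} (hf : Measurable f) (hg : Measurable g) (hh : Measurable h)
    (hfsup : (⨆ x, f x) = 1) (hgsup : (⨆ x, g x) = 1)
    (H : ∀ x y, f x ^ a * g y ^ b ≤ h (a * x + b * y)) :
    ENNReal.ofReal a * (∫⁻ x, f x) + ENNReal.ofReal b * (∫⁻ x, g x) ≤ ∫⁻ x, h x := by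
  have hf1 : ∀ x, f x ≤ 1 := fun x => hfsup ▸ le_iSup f x
  have hg1 : ∀ x, g x ≤ 1 := fun x => hgsup ▸ le_iSup g x
  have layer : ∀ φ : ℝ → ℝ≥0∞, Measurable φ → (∀ x, φ x ≤ 1) →
      (∫⁻ x, φ x) = ∫⁻ t in Set.Ioo (0 : ℝ) 1, volume {x | ENNReal.ofReal t < φ x} := by
    intro φ hφ hφ1
    have hfin : ∀ x, φ x ≠ ∞ := fun x => ne_top_of_le_ne_top ENNReal.one_ne_top (hφ1 x)
    have h1 : (∫⁻ x, φ x) = ∫⁻ t in Set.Ioi (0 : ℝ), volume {x | t < (φ x).toReal} := by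
      rw [← lintegral_eq_lintegral_meas_lt volume (by filter_upwards; intro x; simp)
        hφ.ennreal_toReal.aemeasurable]
      simp [hfin]
    have h2 : ∀ t ∈ Set.Ioi (0 : ℝ), volume {x | t < (φ x).toReal} =
        (Set.Ioo (0 : ℝ) 1).indicator (fun t => volume {x | ENNReal.ofReal t < φ x}) t := by
      intro t ht
      by_cases ht1 : t < 1
      · rw [Set.indicator_of_mem (show t ∈ Set.Ioo 0 1 from ⟨ht, ht1⟩)]
        congr 1
        ext x
        exact (ENNReal.ofReal_lt_iff_lt_toReal (le_of_lt ht) (hfin x)).symm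
      · rw [Set.indicator_of_notMem (fun h => ht1 h.2)]
        convert measure_empty (μ := (volume : Measure ℝ))
        refine Set.eq_empty_of_forall_notMem fun x hx => ht1 (lt_of_lt_of_le hx ?_)
        exact ENNReal.toReal_le_of_le_ofReal zero_le_one (by simpa using hφ1 x)
    rw [h1, setLIntegral_congr_fun measurableSet_Ioi h2, lintegral_indicator measurableSet_Ioo,
      Measure.restrict_restrict measurableSet_Ioo, Set.inter_eq_left.2 Set.Ioo_subset_Ioi_self]
  have hmeas : ∀ φ : ℝ → ℝ≥0∞, Measurable (fun t : ℝ => volume {x | ENNReal.ofReal t < φ x}) :=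
    fun φ => Antitone.measurable fun s t hst => measure_mono fun x hx =>
      lt_of_le_of_lt (ENNReal.ofReal_le_ofReal hst) hx
  calc ENNReal.ofReal a * (∫⁻ x, f x) + ENNReal.ofReal b * (∫⁻ x, g x)
      ≤ ∫⁻ x, min (h x) 1 := ?_
    _ ≤ ∫⁻ x, h x := lintegral_mono fun x => min_le_left _ _
  rw [layer f hf hf1, layer g hg hg1, layer _ (hh.min measurable_const) fun x => min_le_right _ _,
    ← lintegral_const_mul _ (hmeas f), ← lintegral_const_mul _ (hmeas g),
    ← lintegral_add_left ((hmeas f).const_mul _)]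
  refine setLIntegral_mono (hmeas _) fun t ht => ?_
  have ht1 : ENNReal.ofReal t < 1 := by simpa using ht.2
  refine volume_add_le_of_measurableSet ha hb (measurableSet_lt measurable_const hf)
    (measurableSet_lt measurable_const hg) ?_ ?_ ?_
  · exact lt_iSup_iff.1 (hfsup ▸ ht1)
  · exact lt_iSup_iff.1 (hgsup ▸ ht1)
  · intro x hx y hy
    refine lt_min (lt_of_lt_of_le ?_ (H x y)) ht1
    calc ENNReal.ofReal t = ENNReal.ofReal t ^ a * ENNReal.ofReal t ^ b := by
          rw [← ENNReal.rpow_add_of_nonneg _ _ ha.le hb.le, hab, ENNReal.rpow_one]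
      _ < f x ^ a * g y ^ b :=
          ENNReal.mul_lt_mul (ENNReal.rpow_lt_rpow hx ha) (ENNReal.rpow_lt_rpow hy hb)

theorem ENNReal.geom_mean_le_arith_mean (ha : 0 < a) (hb : 0 < b) (hab : a + b = 1)
    (x y : ℝ≥0∞) : x ^ a * y ^ b ≤ ENNReal.ofReal a * x + ENNReal.ofReal b * y := by
  by_cases hx : x = ∞
  · simp [hx, ENNReal.mul_top, ha]
  by_cases hy : y = ∞
  · simp [hy, ENNReal.mul_top, hb]
  lift x to NNReal using hx
  lift y to NNReal using hy
  have := NNReal.geom_mean_le_arith_mean2_weighted ⟨a, ha.le⟩ ⟨b, hb.le⟩ x y (NNReal.eq hab)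
  rw [← ENNReal.coe_rpow_of_nonneg _ ha.le, ← ENNReal.coe_rpow_of_nonneg _ hb.le,
    ENNReal.ofReal, ENNReal.ofReal, Real.toNNReal_of_nonneg ha.le, Real.toNNReal_of_nonneg hb.le]
  exact_mod_cast this

/-- Prékopa–Leindler inequality on the line for bounded functions. -/
theorem prekopaLeindler_real_of_bounded (ha : 0 < a) (hb : 0 < b) (hab : a + b = 1)
    {f g h : ℝ → ℝ≥0∞} (hf : Measurable f) (hg : Measurable g) (hh : Measurable h)
    (hfsup : (⨆ x, f x) ≠ ∞) (hgsup : (⨆ x, g x) ≠ ∞)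
    (H : ∀ x y, f x ^ a * g y ^ b ≤ h (a * x + b * y)) :
    (∫⁻ x, f x) ^ a * (∫⁻ x, g x) ^ b ≤ ∫⁻ x, h x := by
  by_cases hf0 : (⨆ x, f x) = 0
  · have : ∀ x, f x = 0 := by simpa using hf0
    simp [this, ha]
  by_cases hg0 : (⨆ x, g x) = 0
  · have : ∀ x, g x = 0 := by simpa using hg0
    simp [this, hb]
  set p := ⨆ x, f x
  set q := ⨆ x, g x
  have key := prekopaLeindler_real_of_iSup_eq_one ha hb hab (f := fun x => p⁻¹ * f x)
    (g := fun x => q⁻¹ * g x) (h := fun x => ((p⁻¹) ^ a * (q⁻¹) ^ b) * h x)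
    (hf.const_mul _) (hg.const_mul _) (hh.const_mul _)
    (by rw [← ENNReal.mul_iSup]; exact ENNReal.inv_mul_cancel hf0 hfsup)
    (by rw [← ENNReal.mul_iSup]; exact ENNReal.inv_mul_cancel hg0 hgsup)
    (fun x y => by
      rw [ENNReal.mul_rpow_of_nonneg _ _ ha.le, ENNReal.mul_rpow_of_nonneg _ _ hb.le,
        mul_mul_mul_comm]
      gcongr
      exact H x y)
  have key2 := (ENNReal.geom_mean_le_arith_mean ha hb hab _ _).trans key
  rw [lintegral_const_mul _ hf, lintegral_const_mul _ hg, lintegral_const_mul _ hh,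
    ENNReal.mul_rpow_of_nonneg _ _ ha.le, ENNReal.mul_rpow_of_nonneg _ _ hb.le,
    mul_mul_mul_comm] at key2
  refine (ENNReal.mul_le_mul_iff_right ?_ ?_).1 key2
  · simp [hfsup, hgsup, ha.not_gt, hb.not_gt]
  · refine ENNReal.mul_ne_top ?_ ?_
    · exact ENNReal.rpow_ne_top_of_nonneg ha.le (by simpa using hf0)
    · exact ENNReal.rpow_ne_top_of_nonneg hb.le (by simpa using hg0)

/-- Prékopa–Leindler inequality on the line. -/
theorem prekopaLeindler_real (ha : 0 < a) (hb : 0 < b) (hab : a + b = 1)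
    {f g h : ℝ → ℝ≥0∞} (hf : Measurable f) (hg : Measurable g) (hh : Measurable h)
    (H : ∀ x y, f x ^ a * g y ^ b ≤ h (a * x + b * y)) :
    (∫⁻ x, f x) ^ a * (∫⁻ x, g x) ^ b ≤ ∫⁻ x, h x := by
  by_cases hf0 : (∫⁻ x, f x) = 0
  · simp [hf0, ha]
  by_cases hg0 : (∫⁻ x, g x) = 0
  · simp [hg0, hb]
  have trunc : ∀ φ : ℝ → ℝ≥0∞, Measurable φ →
      Filter.Tendsto (fun n : ℕ => ∫⁻ x, min (φ x) n) Filter.atTop (nhds (∫⁻ x, φ x)) := by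
    intro φ hφ
    refine lintegral_tendsto_of_tendsto_of_monotone
      (fun n => (hφ.min measurable_const).aemeasurable) ?_ ?_
    · filter_upwards with x m n hmn
      exact min_le_min_left _ (by exact_mod_cast hmn)
    · filter_upwards with x
      simpa using (tendsto_const_nhds (x := φ x)).min ENNReal.tendsto_nat_nhds_top
  have lim := ENNReal.Tendsto.mul
    ((ENNReal.continuous_rpow_const (y := a)).continuousAt.tendsto.comp (trunc f hf))
    (Or.inl (by simp [hf0, ha.not_gt]))
    ((ENNReal.continuous_rpow_const (y := b)).continuousAt.tendsto.comp (trunc g hg))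
    (Or.inl (by simp [hg0, hb.not_gt]))
  refine le_of_tendsto' lim fun n => ?_
  refine prekopaLeindler_real_of_bounded ha hb hab (hf.min measurable_const)
    (hg.min measurable_const) hh ?_ ?_ fun x y => le_trans ?_ (H x y)
  · exact ne_top_of_le_ne_top (ENNReal.natCast_ne_top n) (iSup_le fun x => min_le_right _ _)
  · exact ne_top_of_le_ne_top (ENNReal.natCast_ne_top n) (iSup_le fun x => min_le_right _ _)
  · gcongr <;> exact min_le_left _ _

theorem lintegral_fin_succ {n : ℕ} {f : (Fin (n + 1) → ℝ) → ℝ≥0∞} (hf : Measurable f) :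
    (∫⁻ x, f x) = ∫⁻ s, ∫⁻ x, f (Fin.cons s x) := by
  have hmp := (volume_preserving_piFinSuccAbove (fun _ : Fin (n + 1) => ℝ) 0).symm
  rw [← hmp.lintegral_comp hf, Measure.volume_eq_prod, lintegral_prod]
  · simp [MeasurableEquiv.piFinSuccAbove, Fin.consEquiv]
  · exact (hf.comp (MeasurableEquiv.measurable _)).aemeasurable

theorem measurable_fin_cons {n : ℕ} :
    Measurable fun p : ℝ × (Fin n → ℝ) => (Fin.cons p.1 p.2 : Fin (n + 1) → ℝ) := by
  refine measurable_pi_lambda _ fun i => ?_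
  refine Fin.cases ?_ (fun j => ?_) i
  · simpa using measurable_fst
  · simpa using! (measurable_pi_apply j).comp measurable_snd

/-- Prékopa–Leindler inequality. -/
theorem prekopaLeindler (ha : 0 < a) (hb : 0 < b) (hab : a + b = 1) (n : ℕ)
    {f g h : (Fin n → ℝ) → ℝ≥0∞} (hf : Measurable f) (hg : Measurable g) (hh : Measurable h)
    (H : ∀ x y, f x ^ a * g y ^ b ≤ h (a • x + b • y)) :
    (∫⁻ x, f x) ^ a * (∫⁻ x, g x) ^ b ≤ ∫⁻ x, h x := by
  induction n with
  | zero =>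
    have hvol : (volume : Measure (Fin 0 → ℝ)) Set.univ = 1 := by
      rw [volume_pi, Measure.pi_of_empty, measure_univ]
    rw [lintegral_unique, lintegral_unique, lintegral_unique, hvol]
    simpa only [mul_one, Subsingleton.elim (_ : Fin 0 → ℝ) default] using H default default
  | succ n ih =>
    rw [lintegral_fin_succ hf, lintegral_fin_succ hg, lintegral_fin_succ hh]
    refine prekopaLeindler_real ha hb hab
      (hf.comp measurable_fin_cons).lintegral_prod_right'
      (hg.comp measurable_fin_cons).lintegral_prod_right'
      (hh.comp measurable_fin_cons).lintegral_prod_right' fun s t => ?_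
    refine ih (hf.comp (measurable_fin_cons.comp measurable_prodMk_left))
      (hg.comp (measurable_fin_cons.comp measurable_prodMk_left))
      (hh.comp (measurable_fin_cons.comp measurable_prodMk_left)) fun x y => ?_
    convert H (Fin.cons s x) (Fin.cons t y) using 2
    ext i
    refine Fin.cases ?_ (fun j => ?_) i <;> simp [smul_eq_mul]

/-- Brunn–Minkowski inequality. -/
theorem brunnMinkowski {d : ℕ} (hd : d ≠ 0) {A B C : Set (Fin d → ℝ)} (hA : MeasurableSet A)
    (hB : MeasurableSet B) (hC : MeasurableSet C) (hA0 : volume A ≠ 0) (hB0 : volume B ≠ 0)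
    (hCtop : volume C ≠ ∞) (hAtop : volume A ≠ ∞) (hBtop : volume B ≠ ∞) (hABC : A + B ⊆ C) :
    ((volume A).toReal ^ (1 / d : ℝ) + (volume B).toReal ^ (1 / d : ℝ)) ^ d
      ≤ (volume C).toReal := by
  set α := (volume A).toReal ^ (1 / d : ℝ) with hα
  set β := (volume B).toReal ^ (1 / d : ℝ) with hβ
  have hαpos : 0 < α := Real.rpow_pos_of_pos (ENNReal.toReal_pos hA0 hAtop) _
  have hβpos : 0 < β := Real.rpow_pos_of_pos (ENNReal.toReal_pos hB0 hBtop) _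
  have hαd : volume A = ENNReal.ofReal (α ^ d) := by
    rw [hα, one_div, Real.rpow_inv_natCast_pow ENNReal.toReal_nonneg hd, ENNReal.ofReal_toReal hAtop]
  have hβd : volume B = ENNReal.ofReal (β ^ d) := by
    rw [hβ, one_div, Real.rpow_inv_natCast_pow ENNReal.toReal_nonneg hd, ENNReal.ofReal_toReal hBtop]
  set σ := α + β with hσ
  have hσpos : 0 < σ := by positivity
  have ha : 0 < α / σ := by positivity
  have hb : 0 < β / σ := by positivity
  have hab : α / σ + β / σ = 1 := by field_simp; rfl
  have scaled : ∀ (γ : ℝ) (D : Set (Fin d → ℝ)), 0 < γ → volume D = ENNReal.ofReal (γ ^ d) →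
      volume ((γ / σ)⁻¹ • D) = ENNReal.ofReal (σ ^ d) := by
    intro γ D hγ hD
    rw [Measure.addHaar_smul, hD, ← ENNReal.ofReal_mul (by positivity), Module.finrank_fin_fun,
      abs_of_pos (by positivity)]
    congr 1
    rw [← mul_pow]
    congr 1
    field_simp
  have key := prekopaLeindler ha hb hab d
    (f := ((α / σ)⁻¹ • A).indicator 1) (g := ((β / σ)⁻¹ • B).indicator 1) (h := C.indicator 1)
    (measurable_one.indicator (hA.const_smul₀ _)) (measurable_one.indicator (hB.const_smul₀ _))
    (measurable_one.indicator hC) (fun x y => by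
      by_cases hx : x ∈ (α / σ)⁻¹ • A
      · by_cases hy : y ∈ (β / σ)⁻¹ • B
        · rw [Set.mem_inv_smul_set_iff₀ ha.ne'] at hx
          rw [Set.mem_inv_smul_set_iff₀ hb.ne'] at hy
          have : (α / σ) • x + (β / σ) • y ∈ C := hABC (Set.add_mem_add hx hy)
          rw [Set.indicator_of_mem this]
          refine mul_le_one' ?_ ?_
          · exact ENNReal.rpow_le_one (Set.indicator_le_self' (by simp) _) ha.le
          · exact ENNReal.rpow_le_one (Set.indicator_le_self' (by simp) _) hb.le
        · rw [Set.indicator_of_notMem hy, ENNReal.zero_rpow_of_pos hb, mul_zero]; exact zero_le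
      · rw [Set.indicator_of_notMem hx, ENNReal.zero_rpow_of_pos ha, zero_mul]; exact zero_le)
  rw [lintegral_indicator_one (hA.const_smul₀ _), lintegral_indicator_one (hB.const_smul₀ _),
    lintegral_indicator_one hC, scaled α A hαpos hαd, scaled β B hβpos hβd,
    ← ENNReal.rpow_add_of_nonneg _ _ ha.le hb.le, hab, ENNReal.rpow_one] at key
  exact (ENNReal.ofReal_le_iff_le_toReal hCtop).1 key

end PrekopaLeindler

section LatticeGrowth

variable {d k : ℕ}

/-- The union of the half-open unit cubes with lower corners in `L`. -/
def cubeUnion (L : Finset (Fin d → ℤ)) : Set (Fin d → ℝ) := {x | (fun j => ⌊x j⌋) ∈ L}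

theorem measurableSet_cubeUnion (L : Finset (Fin d → ℤ)) : MeasurableSet (cubeUnion L) :=
  (measurable_pi_lambda _ fun j => Int.measurable_floor.comp (measurable_pi_apply j))
    L.measurableSet

theorem volume_cubeUnion (L : Finset (Fin d → ℤ)) : volume (cubeUnion L) = L.card := by
  have hm : Measurable fun (x : Fin d → ℝ) j => ⌊x j⌋ :=
    measurable_pi_lambda _ fun j => Int.measurable_floor.comp (measurable_pi_apply j)
  have hcube : ∀ v : Fin d → ℤ, volume ((fun (x : Fin d → ℝ) j => ⌊x j⌋) ⁻¹' {v}) = 1 := by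
    intro v
    have : (fun (x : Fin d → ℝ) j => ⌊x j⌋) ⁻¹' {v} =
        Set.univ.pi fun j => Set.Ico (v j : ℝ) (v j + 1) := by
      ext x
      simp [funext_iff, Int.floor_eq_iff]
    rw [this, volume_pi_pi]
    simp
  change volume ((fun (x : Fin d → ℝ) j => ⌊x j⌋) ⁻¹' (L : Set (Fin d → ℤ))) = _
  rw [← sum_measure_preimage_singleton L fun v _ => hm (measurableSet_singleton v)]
  simp [hcube]

/-- Sums of at most `r` copies of each of the vectors `u i`. -/
def stepSums (u : Fin k → Fin d → ℤ) (r : ℕ) : Finset (Fin d → ℤ) :=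
  Finset.univ.image fun T : Finset (Fin k × Fin r) => ∑ a ∈ T, u a.1

theorem sum_smul_mem_stepSums (u : Fin k → Fin d → ℤ) {r : ℕ} {m : Fin k → ℤ}
    (hm0 : ∀ i, 0 ≤ m i) (hm : ∀ i, m i ≤ r) : ∑ i, m i • u i ∈ stepSums u r := by
  refine Finset.mem_image.2 ⟨Finset.univ.filter fun a => (a.2 : ℤ) < m a.1, Finset.mem_univ _, ?_⟩
  rw [Finset.sum_filter, Fintype.sum_prod_type]
  refine Finset.sum_congr rfl fun i _ => ?_
  simp only
  rw [← Finset.sum_filter, Finset.sum_const, ← natCast_zsmul]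
  congr 1
  lift m i to ℕ using hm0 i with n hn
  have hn' : n ≤ r := by have := hm i; omega
  have : (Finset.univ.filter fun j : Fin r => ((j : ℕ) : ℤ) < (n : ℤ)).card = n := by
    simp only [Nat.cast_lt, Fin.card_filter_val_lt, hn', min_eq_right]
  exact_mod_cast this

theorem exists_sum_smul_eq {u : Fin k → Fin d → ℤ}
    (hgen : AddSubgroup.closure (Set.range u) = ⊤) (v : Fin d → ℤ) :
    ∃ m : Fin k → ℤ, ∑ i, m i • u i = v := by
  have hv : v ∈ AddSubgroup.closure (Set.range u) := hgen ▸ AddSubgroup.mem_top v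
  rw [← Submodule.span_int_eq_addSubgroupClosure, Submodule.mem_toAddSubgroup,
    Submodule.mem_span_range_iff_exists_fun] at hv
  exact hv

theorem exists_bounded_coeffs {u : Fin k → Fin d → ℤ}
    (hgen : AddSubgroup.closure (Set.range u) = ⊤) (F : Finset (Fin d → ℤ)) :
    ∃ q : ℕ, ∀ v ∈ F, ∃ m : Fin k → ℤ, (∀ i, |m i| ≤ q) ∧ ∑ i, m i • u i = v := by
  choose m hm using exists_sum_smul_eq hgen
  refine ⟨∑ v ∈ F, ∑ i, (m v i).natAbs, fun v hv => ⟨m v, fun i => ?_, hm v⟩⟩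
  rw [Int.abs_eq_natAbs]
  norm_cast
  calc (m v i).natAbs ≤ ∑ i, (m v i).natAbs :=
        Finset.single_le_sum (f := fun i => (m v i).natAbs) (fun _ _ => Nat.zero_le _)
          (Finset.mem_univ i)
    _ ≤ _ := Finset.single_le_sum (f := fun v => ∑ i, (m v i).natAbs) (fun _ _ => Nat.zero_le _) hv

theorem convexHull_subset_zonotope (u : Fin k → Fin d → ℤ) :
    convexHull ℝ (toReal' '' ((∑ i, ({0, u i} : Finset (Fin d → ℤ)) : Finset (Fin d → ℤ)) :
      Set (Fin d → ℤ))) ⊆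
      (fun t : Fin k → ℝ => ∑ i, t i • toReal' (u i)) '' Set.Icc 0 1 := by
  refine convexHull_min ?_ ((convex_Icc (0 : Fin k → ℝ) 1).is_linear_image
    (Fintype.linearCombination ℝ fun i => toReal' (u i)).isLinear)
  rintro _ ⟨z, hz, rfl⟩
  rw [Finset.coe_sum, Set.mem_finsetSum] at hz
  obtain ⟨g, hg, rfl⟩ := hz
  refine ⟨fun i => if g i = 0 then 0 else 1, ⟨fun i => ?_, fun i => ?_⟩, ?_⟩
  · dsimp; split_ifs <;> simp
  · dsimp; split_ifs <;> simp
  · ext j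
    simp only [toReal', Finset.sum_apply, Pi.smul_apply, smul_eq_mul, Int.cast_sum]
    refine Finset.sum_congr rfl fun i _ => ?_
    have := @hg i (Finset.mem_univ i)
    simp only [Finset.coe_insert, Finset.coe_singleton, Set.mem_insert_iff,
      Set.mem_singleton_iff] at this
    split_ifs with h
    · simp [h]
    · rw [this.resolve_left h, one_mul]

theorem exists_cubeUnion_add_subset {u : Fin k → Fin d → ℤ}
    (hgen : AddSubgroup.closure (Set.range u) = ⊤) :
    ∃ (q : ℕ) (w : Fin d → ℤ), ∀ (r : ℕ) (L : Finset (Fin d → ℤ)),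
      cubeUnion L + (r : ℝ) • ((fun t : Fin k → ℝ => ∑ i, t i • toReal' (u i)) '' Set.Icc 0 1) ⊆
        cubeUnion (L + stepSums u (r + q) + {w}) := by
  obtain ⟨M, hM⟩ : ∃ M : ℤ, ∀ j, ∑ i, |u i j| ≤ M :=
    ⟨∑ j, ∑ i, |u i j|, fun j => Finset.single_le_sum (f := fun j => ∑ i, |u i j|)
      (fun _ _ => by positivity) (Finset.mem_univ j)⟩
  obtain ⟨q, hq⟩ := exists_bounded_coeffs hgen
    (Finset.Icc (fun _ => -(M + 1)) (fun _ => M + 1) : Finset (Fin d → ℤ))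
  refine ⟨2 * q, -(∑ i, (q : ℤ) • u i), fun r L => ?_⟩
  rintro _ ⟨x, hx, _, ⟨_, ⟨t, ⟨ht0, ht1⟩, rfl⟩, rfl⟩, rfl⟩
  have hs0 : ∀ i, 0 ≤ r * t i := fun i => mul_nonneg (Nat.cast_nonneg r) (ht0 i)
  have hsr : ∀ i, r * t i ≤ r := fun i => mul_le_of_le_one_right (Nat.cast_nonneg r) (ht1 i)
  set e : Fin d → ℤ := fun j => ⌊x j + ∑ i, r * t i * u i j⌋ - ⌊x j⌋ - ∑ i, ⌊r * t i⌋ * u i j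
    with he
  have he_mem : e ∈ (Finset.Icc (fun _ => -(M + 1)) (fun _ => M + 1) : Finset (Fin d → ℤ)) := by
    have key : ∀ j, |∑ i, Int.fract (r * t i) * (u i j : ℝ)| ≤ M := by
      intro j
      calc |∑ i, Int.fract (r * t i) * (u i j : ℝ)|
          ≤ ∑ i, |Int.fract (r * t i) * (u i j : ℝ)| := Finset.abs_sum_le_sum_abs _ _
        _ ≤ ∑ i, |(u i j : ℝ)| := by
            refine Finset.sum_le_sum fun i _ => ?_
            rw [abs_mul, abs_of_nonneg (Int.fract_nonneg _)]
            exact mul_le_of_le_one_left (abs_nonneg _) (Int.fract_lt_one _).le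
        _ ≤ M := by exact_mod_cast hM j
    have heq : ∀ j, e j = ⌊Int.fract (x j) + ∑ i, Int.fract (r * t i) * (u i j : ℝ)⌋ := by
      intro j
      have : x j + ∑ i, r * t i * u i j = (Int.fract (x j) +
          ∑ i, Int.fract (r * t i) * (u i j : ℝ)) +
          ((⌊x j⌋ + ∑ i, ⌊r * t i⌋ * u i j : ℤ) : ℝ) := by
        have h2 : ∑ i, r * t i * (u i j : ℝ) = ∑ i, Int.fract (r * t i) * (u i j : ℝ) +
            ∑ i, (⌊r * t i⌋ : ℝ) * (u i j : ℝ) := by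
          rw [← Finset.sum_add_distrib]
          exact Finset.sum_congr rfl fun i _ => by rw [← add_mul, Int.fract_add_floor]
        rw [h2]
        push_cast
        linarith [Int.fract_add_floor (x j)]
      simp only [he]
      rw [this, Int.floor_add_intCast]
      ring
    rw [Finset.mem_Icc]
    refine ⟨fun j => ?_, fun j => ?_⟩
    · rw [heq, Int.le_floor]
      have := abs_le.1 (key j)
      push_cast
      linarith [Int.fract_nonneg (x j)]
    · rw [heq, ← Int.lt_add_one_iff, Int.floor_lt]
      have := abs_le.1 (key j)
      push_cast
      linarith [Int.fract_lt_one (x j)]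
  obtain ⟨m, hmq, hme⟩ := hq e he_mem
  refine Finset.mem_add.2 ⟨_, Finset.add_mem_add hx (sum_smul_mem_stepSums u (r := r + 2 * q)
    (m := fun i => ⌊r * t i⌋ + m i + q) (fun i => ?_) fun i => ?_), _, Finset.mem_singleton_self _,
      ?_⟩
  · have h1 := Int.floor_nonneg.2 (hs0 i)
    have h2 := abs_le.1 (hmq i)
    linarith
  · have h1 : ⌊r * t i⌋ ≤ r := Int.floor_le_iff.2 (by have := hsr i; push_cast; linarith)
    have h2 := abs_le.1 (hmq i)
    push_cast
    linarith
  · have hsplit : ∑ i, (⌊r * t i⌋ + m i + (q : ℤ)) • u i =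
        ∑ i, ⌊r * t i⌋ • u i + e + ∑ i, (q : ℤ) • u i := by
      simp only [add_smul, Finset.sum_add_distrib, hme]
    simp only [hsplit]
    ext j
    simp only [he, Pi.add_apply, Pi.neg_apply, Finset.sum_apply, Pi.smul_apply, smul_eq_mul,
      toReal', Finset.mul_sum, mul_assoc]
    ring

theorem add_mul_pow_le_add_pow {x y : ℝ} (hx : 0 < x) (hy : 0 ≤ y) (n : ℕ) :
    x ^ (n + 1) + (n + 1) * y * x ^ n ≤ (x + y) ^ (n + 1) := by
  have h := one_add_mul_le_pow (a := y / x) (by have : 0 ≤ y / x := by positivity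
                                                linarith) (n + 1)
  have h2 : (x + y) ^ (n + 1) = x ^ (n + 1) * (1 + y / x) ^ (n + 1) := by
    rw [← mul_pow]; congr 1; field_simp
  rw [h2]
  refine le_trans (le_of_eq ?_) (mul_le_mul_of_nonneg_left h (by positivity))
  push_cast
  field_simp
  ring

/-- Sumsets with a large discrete zonotope grow at least as fast as in the continuous setting. -/
theorem exists_card_add_stepSums_ge (hd : 1 ≤ d) {u : Fin k → Fin d → ℤ}
    (hgen : AddSubgroup.closure (Set.range u) = ⊤) {Z : Set (Fin d → ℝ)}
    (hZ : Z = convexHull ℝ (toReal' '' ((∑ i, ({0, u i} : Finset (Fin d → ℤ)) :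
      Finset (Fin d → ℤ)) : Set (Fin d → ℤ)))) (hZ0 : volume Z ≠ 0) :
    ∃ q : ℕ, ∀ r : ℕ, 1 ≤ r → ∀ L : Finset (Fin d → ℤ), L.Nonempty →
      L.card + r * (d * (volume Z).toReal ^ (1 / d : ℝ) * (L.card : ℝ) ^ (1 - 1 / d : ℝ)) ≤
        ((L + stepSums u (r + q)).card : ℝ) := by
  obtain ⟨q, w, hqw⟩ := exists_cubeUnion_add_subset hgen
  refine ⟨q, fun r hr L hL => ?_⟩
  have hr0 : (0 : ℝ) < r := by exact_mod_cast hr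
  have hZc : IsCompact Z := by
    rw [hZ]
    exact ((Finset.finite_toSet _).image _).isCompact_convexHull ℝ
  have hd0 : d ≠ 0 := by omega
  have hvol : volume ((r : ℝ) • Z) = ENNReal.ofReal (r ^ d) * volume Z := by
    rw [Measure.addHaar_smul, Module.finrank_fin_fun, abs_of_pos (by positivity)]
  have hsub : cubeUnion L + (r : ℝ) • Z ⊆ cubeUnion (L + stepSums u (r + q) + {w}) :=
    (Set.add_subset_add_left (Set.smul_set_mono (hZ ▸ convexHull_subset_zonotope u))).trans
      (hqw r L)
  have key := brunnMinkowski hd0 (measurableSet_cubeUnion L) (hZc.smul (r : ℝ)).measurableSet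
    (measurableSet_cubeUnion _) (by simpa [volume_cubeUnion] using hL.ne_empty)
    (by rw [hvol]; exact mul_ne_zero (by simp; omega) hZ0)
    (by simp [volume_cubeUnion]) (by simp [volume_cubeUnion]) (hZc.smul (r : ℝ)).measure_lt_top.ne
    hsub
  have hroot : (volume ((r : ℝ) • Z)).toReal ^ (1 / d : ℝ) =
      r * (volume Z).toReal ^ (1 / d : ℝ) := by
    rw [hvol, ENNReal.toReal_mul, ENNReal.toReal_ofReal (by positivity),
      Real.mul_rpow (by positivity) ENNReal.toReal_nonneg, one_div,
      Real.pow_rpow_inv_natCast hr0.le hd0]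
  rw [hroot, volume_cubeUnion, volume_cubeUnion, ENNReal.toReal_natCast, ENNReal.toReal_natCast,
    Finset.card_add_singleton] at key
  refine le_trans ?_ key
  have hLpos : (0 : ℝ) < L.card := by exact_mod_cast hL.card_pos
  obtain ⟨n, rfl⟩ : ∃ n, d = n + 1 := ⟨d - 1, by omega⟩
  have hpow := add_mul_pow_le_add_pow (Real.rpow_pos_of_pos hLpos (1 / (n + 1 : ℕ) : ℝ))
    (mul_nonneg hr0.le (Real.rpow_nonneg ENNReal.toReal_nonneg _)) n
    (y := r * (volume Z).toReal ^ (1 / (n + 1 : ℕ) : ℝ))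
  have e1 : ((L.card : ℝ) ^ (1 / (n + 1 : ℕ) : ℝ)) ^ (n + 1) = L.card := by
    rw [one_div, Real.rpow_inv_natCast_pow hLpos.le hd0]
  have e2 : ((L.card : ℝ) ^ (1 / (n + 1 : ℕ) : ℝ)) ^ n =
      (L.card : ℝ) ^ (1 - 1 / (n + 1 : ℕ) : ℝ) := by
    rw [← Real.rpow_natCast, ← Real.rpow_mul hLpos.le]
    congr 1
    push_cast
    field_simp
    ring
  rw [e1, e2] at hpow
  refine le_trans (le_of_eq ?_) hpow
  push_cast
  ring

end LatticeGrowth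

section EdgeBoundary

variable {G : Type*} [DecidableEq G]

/-- The integer-valued indicator function of `S`. -/
def ind (S : Finset G) (v : G) : ℤ := if v ∈ S then 1 else 0

theorem sum_ind_eq_card {S W : Finset G} (h : S ⊆ W) : ∑ v ∈ W, ind S v = S.card := by
  simp [ind, Finset.sum_ite_mem, Finset.inter_eq_right.2 h]

variable [AddCommGroup G]

theorem card_filter_sub_notMem (S : Finset G) (x : G) :
    (S.filter fun v => v - x ∉ S).card = (S.filter fun v => v + x ∉ S).card := by
  have h : (S.filter fun v => v - x ∈ S).card = (S.filter fun v => v + x ∈ S).card :=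
    Finset.card_bij' (fun v _ => v - x) (fun v _ => v + x)
      (by simp +contextual) (by simp +contextual) (by simp) (by simp)
  have h1 := Finset.card_filter_add_card_filter_not (s := S) (fun v => v - x ∈ S)
  have h2 := Finset.card_filter_add_card_filter_not (s := S) (fun v => v + x ∈ S)
  omega

theorem sum_max_ind_sub_le (S W : Finset G) (x : G) :
    ∑ v ∈ W, max (ind S (v - x) - ind S v) 0 ≤ (S.filter fun v => v + x ∉ S).card := by
  have h : ∀ v, max (ind S (v - x) - ind S v) 0 = if v - x ∈ S ∧ v ∉ S then 1 else 0 := by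
    intro v
    by_cases h1 : v - x ∈ S <;> by_cases h2 : v ∈ S <;> simp [ind, h1, h2]
  simp only [h, Finset.sum_boole]
  norm_cast
  refine Finset.card_le_card_of_injOn (fun v => v - x) ?_ fun _ _ _ _ => sub_left_injective.eq_iff.1
  intro v hv
  simp only [Finset.coe_filter, Set.mem_ofPred_eq] at hv
  simpa using hv.2

theorem sum_max_ind_le (S W : Finset G) (x : G) :
    ∑ v ∈ W, max (ind S v - ind S (v - x)) 0 ≤ (S.filter fun v => v + x ∉ S).card := by
  have h : ∀ v, max (ind S v - ind S (v - x)) 0 = if v ∈ S ∧ v - x ∉ S then 1 else 0 := by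
    intro v
    by_cases h1 : v - x ∈ S <;> by_cases h2 : v ∈ S <;> simp [ind, h1, h2]
  simp only [h, Finset.sum_boole, ← card_filter_sub_notMem S x]
  norm_cast
  refine Finset.card_le_card fun v hv => ?_
  simp only [Finset.mem_filter] at hv ⊢
  exact hv.2

theorem sum_abs_ind_sub_le (S W : Finset G) (x : G) :
    ∑ v ∈ W, |ind S (v - x) - ind S v| ≤ 2 * (S.filter fun v => v + x ∉ S).card := by
  have h : ∀ v, |ind S (v - x) - ind S v| =
      max (ind S (v - x) - ind S v) 0 + max (ind S v - ind S (v - x)) 0 := fun v => by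
    rcases abs_cases (ind S (v - x) - ind S v) with h | h <;> omega
  simp only [h, Finset.sum_add_distrib]
  linarith [sum_max_ind_sub_le S W x, sum_max_ind_le S W x]

theorem sum_sub_eq_sum_image (W : Finset G) (x : G) (F : G → ℤ) :
    ∑ v ∈ W, F (v - x) = ∑ v ∈ W.image (· - x), F v :=
  (Finset.sum_image fun _ _ _ _ => sub_left_injective.eq_iff.1).symm

/-- The number of representations of `v` as a sum of elements of `B` and `S`. -/
def repCount (B S : Finset G) (v : G) : ℤ := ∑ b ∈ B, ind S (v - b)

theorem repCount_sub (B S : Finset G) (v x : G) :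
    repCount B S (v - x) = ∑ b ∈ B.image (· + x), ind S (v - b) := by
  rw [Finset.sum_image fun _ _ _ _ => add_left_injective x |>.eq_iff.1]
  exact Finset.sum_congr rfl fun b _ => by rw [sub_sub, add_comm]

theorem sum_max_repCount_sub_le (B S W : Finset G) (x : G) :
    ∑ v ∈ W, max (repCount B S (v - x) - repCount B S v) 0 ≤
      B.card * (S.filter fun v => v + x ∉ S).card := by
  calc ∑ v ∈ W, max (repCount B S (v - x) - repCount B S v) 0
      ≤ ∑ v ∈ W, ∑ b ∈ B, max (ind S (v - b - x) - ind S (v - b)) 0 := by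
        refine Finset.sum_le_sum fun v _ => max_le ?_ (Finset.sum_nonneg fun _ _ => le_max_right _ _)
        rw [repCount, repCount, ← Finset.sum_sub_distrib]
        refine Finset.sum_le_sum fun b _ => ?_
        rw [sub_right_comm]
        exact le_max_left _ _
    _ = ∑ b ∈ B, ∑ v ∈ W, max (ind S (v - b - x) - ind S (v - b)) 0 := Finset.sum_comm
    _ ≤ ∑ _b ∈ B, ((S.filter fun v => v + x ∉ S).card : ℤ) := by
        refine Finset.sum_le_sum fun b _ => ?_
        rw [sum_sub_eq_sum_image W b fun v => max (ind S (v - x) - ind S v) 0]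
        exact sum_max_ind_sub_le _ _ _
    _ = _ := by simp

/-- The mixed second difference of the representation counts. -/
def repCountDiff (B S : Finset G) (x y v : G) : ℤ :=
  repCount B S (v - y - x) - repCount B S (v - y) - (repCount B S (v - x) - repCount B S v)

theorem sum_abs_repCountDiff_le (B S W : Finset G) (x y : G) :
    ∑ v ∈ W, |repCountDiff B S x y v| ≤
      4 * (B.filter fun b => b + y ∉ B).card * (S.filter fun v => v + x ∉ S).card := by
  set B' := B.image (· + y)
  set g : G → ℤ := fun v => ind S (v - x) - ind S v
  have hg : ∀ (D : Finset G), ∑ v ∈ W, ∑ b ∈ D, |g (v - b)| ≤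
      D.card * (2 * (S.filter fun v => v + x ∉ S).card) := by
    intro D
    rw [Finset.sum_comm]
    refine (Finset.sum_le_card_nsmul D _ (2 * (S.filter fun v => v + x ∉ S).card : ℤ)
      fun b _ => ?_).trans (by simp)
    rw [sum_sub_eq_sum_image W b fun v => |g v|]
    exact sum_abs_ind_sub_le _ _ _
  have hdiff : ∀ v, |repCountDiff B S x y v| ≤
      ∑ b ∈ B' \ B, |g (v - b)| + ∑ b ∈ B \ B', |g (v - b)| := by
    intro v
    have h1 : repCountDiff B S x y v = ∑ b ∈ B', g (v - b) - ∑ b ∈ B, g (v - b) := by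
      rw [repCountDiff, sub_right_comm v y x, repCount_sub B S (v - x) y, repCount_sub B S v y,
        repCount, repCount]
      simp only [g, Finset.sum_sub_distrib, sub_right_comm v _ x]
      ring
    rw [h1, ← Finset.sum_sdiff_sub_sum_sdiff]
    exact (abs_sub _ _).trans
      (add_le_add (Finset.abs_sum_le_sum_abs _ _) (Finset.abs_sum_le_sum_abs _ _))
  have hcard : (B \ B').card = (B.filter fun b => b + y ∉ B).card := by
    rw [← card_filter_sub_notMem]
    congr 1
    ext b
    simp [B', sub_eq_add_neg]
  have hcard' : (B' \ B).card = (B \ B').card :=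
    Finset.card_sdiff_comm (Finset.card_image_of_injective _ (add_left_injective y))
  calc ∑ v ∈ W, |repCountDiff B S x y v|
      ≤ ∑ v ∈ W, (∑ b ∈ B' \ B, |g (v - b)| + ∑ b ∈ B \ B', |g (v - b)|) :=
        Finset.sum_le_sum fun v _ => hdiff v
    _ ≤ _ := by
        rw [Finset.sum_add_distrib]
        have h1 := hg (B' \ B)
        have h2 := hg (B \ B')
        rw [hcard', hcard] at h1
        rw [hcard] at h2
        linarith

/-- The elements represented at least `j` times. -/
def level (B S : Finset G) (j : ℤ) : Finset G := (S + B).filter fun v => j ≤ repCount B S v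

theorem mem_level {B S : Finset G} {j : ℤ} (hj : 1 ≤ j) {v : G} :
    v ∈ level B S j ↔ j ≤ repCount B S v := by
  simp only [level, Finset.mem_filter, and_iff_right_iff_imp]
  intro h
  by_contra hv
  have : repCount B S v = 0 := Finset.sum_eq_zero fun b hb => by
    rw [ind, if_neg]
    exact fun hS => hv (by simpa using Finset.add_mem_add hS hb)
  omega

/-- The expansion of the level sets is controlled by the increments of the counts. -/
theorem sum_card_level_add_sub_le (B S P : Finset G) (N : ℤ) (Y : G → ℤ) (hY0 : ∀ v, 0 ≤ Y v)
    (hY : ∀ v, ∀ z ∈ P, repCount B S (v - z) ≤ repCount B S v + Y v) (h0 : 0 ∈ P) :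
    ∑ j ∈ Finset.Icc 1 N, (((level B S j + P).card : ℤ) - (level B S j).card) ≤
      ∑ v ∈ S + B + P, Y v := by
  have hsub : ∀ j, level B S j + P ⊆ S + B + P := fun j =>
    Finset.add_subset_add_right (Finset.filter_subset _ _)
  have hsub' : ∀ j, level B S j ⊆ S + B + P := fun j v hv =>
    hsub j (by simpa using Finset.add_mem_add hv h0)
  calc ∑ j ∈ Finset.Icc 1 N, (((level B S j + P).card : ℤ) - (level B S j).card)
      = ∑ j ∈ Finset.Icc 1 N, ∑ v ∈ S + B + P, (ind (level B S j + P) v - ind (level B S j) v) :=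
        Finset.sum_congr rfl fun j _ => by
          rw [Finset.sum_sub_distrib, sum_ind_eq_card (hsub j), sum_ind_eq_card (hsub' j)]
    _ = ∑ v ∈ S + B + P, ∑ j ∈ Finset.Icc 1 N, (ind (level B S j + P) v - ind (level B S j) v) :=
        Finset.sum_comm
    _ ≤ _ := Finset.sum_le_sum fun v _ => ?_
  calc ∑ j ∈ Finset.Icc 1 N, (ind (level B S j + P) v - ind (level B S j) v)
      ≤ ∑ j ∈ Finset.Icc 1 N,
          if j ∈ Finset.Ioc (repCount B S v) (repCount B S v + Y v) then 1 else 0 := by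
        refine Finset.sum_le_sum fun j hj => ?_
        have hj1 := (Finset.mem_Icc.1 hj).1
        by_cases h1 : v ∈ level B S j + P
        · by_cases h2 : v ∈ level B S j
          · simp only [ind, h1, h2, if_true, sub_self]
            split_ifs <;> norm_num
          · obtain ⟨w, hw, z, hz, rfl⟩ := Finset.mem_add.1 h1
            rw [mem_level hj1] at h2 hw
            have := hY (w + z) z hz
            rw [add_sub_cancel_right] at this
            rw [if_pos (Finset.mem_Ioc.2 ⟨not_le.1 h2, hw.trans this⟩)]
            simp only [ind]
            split_ifs <;> norm_num
        · simp only [ind, h1, if_false]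
          split_ifs <;> norm_num
    _ = ((Finset.Icc 1 N ∩ Finset.Ioc (repCount B S v) (repCount B S v + Y v)).card : ℤ) := by
        rw [Finset.sum_ite_mem]; simp
    _ ≤ ((Finset.Ioc (repCount B S v) (repCount B S v + Y v)).card : ℤ) := by
        exact_mod_cast Finset.card_le_card Finset.inter_subset_right
    _ = Y v := by
        rw [Int.card_Ioc, add_sub_cancel_left, Int.toNat_of_nonneg (hY0 v)]

theorem card_sdiff_level_mul_le (B S : Finset G) {j : ℤ} (hj : 1 ≤ j) :
    ((S \ level B S j).card : ℤ) * (B.card - j) ≤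
      ∑ b ∈ B, ((S.filter fun v => v + b ∉ S).card : ℤ) := by
  have hc : ∀ v, (B.card : ℤ) - repCount B S v = ∑ b ∈ B, (1 - ind S (v - b)) := by
    intro v
    simp [repCount]
  have hnn : ∀ v, 0 ≤ (B.card : ℤ) - repCount B S v := by
    intro v
    rw [hc]
    refine Finset.sum_nonneg fun b _ => ?_
    rw [ind]
    split_ifs <;> norm_num
  calc ((S \ level B S j).card : ℤ) * (B.card - j)
      = ∑ _v ∈ S \ level B S j, ((B.card : ℤ) - j) := by simp [mul_sub]
    _ ≤ ∑ v ∈ S \ level B S j, ((B.card : ℤ) - repCount B S v) := by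
        refine Finset.sum_le_sum fun v hv => ?_
        have := (Finset.mem_sdiff.1 hv).2
        rw [mem_level hj] at this
        omega
    _ ≤ ∑ v ∈ S, ((B.card : ℤ) - repCount B S v) :=
        Finset.sum_le_sum_of_subset_of_nonneg Finset.sdiff_subset fun v _ _ => hnn v
    _ = ∑ b ∈ B, ∑ v ∈ S, (1 - ind S (v - b)) := by
        simp only [hc]
        exact Finset.sum_comm
    _ = _ := by
        refine Finset.sum_congr rfl fun b _ => ?_
        rw [← card_filter_sub_notMem, ← Finset.sum_boole]
        refine Finset.sum_congr rfl fun v _ => ?_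
        rw [ind]
        split_ifs <;> norm_num

end EdgeBoundary

section Growth

variable {d k : ℕ}

theorem zero_mem_stepSums (u : Fin k → Fin d → ℤ) (r : ℕ) : 0 ∈ stepSums u r :=
  Finset.mem_image.2 ⟨∅, Finset.mem_univ _, by simp⟩

/-- Total second-order variation of the counts over a discrete zonotope. -/
def repCountVariation (u : Fin k → Fin d → ℤ) (r : ℕ) (B S : Finset (Fin d → ℤ))
    (v : Fin d → ℤ) : ℤ :=
  ∑ z ∈ stepSums u r, ∑ i, ∑ j, |repCountDiff B S (u i) (u j) (v - z)|

theorem repCountVariation_nonneg (u : Fin k → Fin d → ℤ) (r : ℕ) (B S : Finset (Fin d → ℤ))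
    (v : Fin d → ℤ) : 0 ≤ repCountVariation u r B S v := by
  unfold repCountVariation
  positivity

theorem abs_repCountDiff_le_variation (u : Fin k → Fin d → ℤ) {r : ℕ} (B S : Finset (Fin d → ℤ))
    (v : Fin d → ℤ) {z : Fin d → ℤ} (hz : z ∈ stepSums u r) (i j : Fin k) :
    |repCountDiff B S (u i) (u j) (v - z)| ≤ repCountVariation u r B S v :=
  calc |repCountDiff B S (u i) (u j) (v - z)|
      ≤ ∑ j, |repCountDiff B S (u i) (u j) (v - z)| :=
        Finset.single_le_sum (f := fun j => |repCountDiff B S (u i) (u j) (v - z)|)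
          (fun _ _ => abs_nonneg _) (Finset.mem_univ j)
    _ ≤ ∑ i, ∑ j, |repCountDiff B S (u i) (u j) (v - z)| :=
        Finset.single_le_sum (f := fun i => ∑ j, |repCountDiff B S (u i) (u j) (v - z)|)
          (fun _ _ => by positivity) (Finset.mem_univ i)
    _ ≤ _ := Finset.single_le_sum
          (f := fun z => ∑ i, ∑ j, |repCountDiff B S (u i) (u j) (v - z)|)
          (fun _ _ => by positivity) hz

theorem repCount_increment_le (u : Fin k → Fin d → ℤ) {r : ℕ} (B S : Finset (Fin d → ℤ))
    (v : Fin d → ℤ) (i : Fin k) (T : Finset (Fin k × Fin r)) :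
    repCount B S (v - ∑ a ∈ T, u a.1 - u i) - repCount B S (v - ∑ a ∈ T, u a.1) ≤
      repCount B S (v - u i) - repCount B S v + T.card * repCountVariation u r B S v := by
  induction T using Finset.induction_on with
  | empty => simp
  | insert a T ha ih =>
    have h := le_of_abs_le (abs_repCountDiff_le_variation u B S v
      (Finset.mem_image.2 ⟨T, Finset.mem_univ _, rfl⟩) i a.1)
    rw [repCountDiff] at h
    rw [Finset.sum_insert ha, Finset.card_insert_of_notMem ha, add_comm (u a.1), ← sub_sub]
    push_cast
    linarith

/-- A bound for the increments of the counts over a discrete zonotope. -/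
def incrementBound (u : Fin k → Fin d → ℤ) (r : ℕ) (B S : Finset (Fin d → ℤ))
    (v : Fin d → ℤ) : ℤ :=
  r * ∑ i, max (repCount B S (v - u i) - repCount B S v) 0 +
    (k * r) ^ 2 * repCountVariation u r B S v

theorem repCount_sub_le_add_incrementBound (u : Fin k → Fin d → ℤ) {r : ℕ}
    (B S : Finset (Fin d → ℤ)) (v : Fin d → ℤ) {z : Fin d → ℤ} (hz : z ∈ stepSums u r) :
    repCount B S (v - z) ≤ repCount B S v + incrementBound u r B S v := by
  have hcard : ∀ T : Finset (Fin k × Fin r), (T.card : ℤ) ≤ k * r := fun T => by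
    exact_mod_cast (Finset.card_le_univ T).trans (by simp)
  have hE := repCountVariation_nonneg u r B S v
  have hpath : ∀ T : Finset (Fin k × Fin r), repCount B S (v - ∑ a ∈ T, u a.1) ≤
      repCount B S v + ∑ a ∈ T, (max (repCount B S (v - u a.1) - repCount B S v) 0 +
        k * r * repCountVariation u r B S v) := by
    intro T
    induction T using Finset.induction_on with
    | empty => simp
    | insert a T ha ih =>
      have h := repCount_increment_le u B S v a.1 T
      have h2 := mul_le_mul_of_nonneg_right (hcard T) hE
      have h3 := le_max_left (repCount B S (v - u a.1) - repCount B S v) 0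
      rw [Finset.sum_insert ha, Finset.sum_insert ha, add_comm (u a.1), ← sub_sub]
      linarith
  obtain ⟨T, -, rfl⟩ := Finset.mem_image.1 hz
  refine (hpath T).trans (add_le_add_right ?_ _)
  refine (Finset.sum_le_sum_of_subset_of_nonneg (Finset.subset_univ T)
    fun a _ _ => by positivity).trans (le_of_eq ?_)
  rw [Fintype.sum_prod_type, incrementBound]
  simp only [Finset.sum_const, Finset.card_univ, Fintype.card_fin, Finset.sum_add_distrib,
    nsmul_eq_mul, Finset.mul_sum, mul_add]
  ring

theorem incrementBound_nonneg (u : Fin k → Fin d → ℤ) (r : ℕ) (B S : Finset (Fin d → ℤ))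
    (v : Fin d → ℤ) : 0 ≤ incrementBound u r B S v := by
  have := repCountVariation_nonneg u r B S v
  unfold incrementBound
  positivity

theorem sum_incrementBound_le (u : Fin k → Fin d → ℤ) (r M : ℕ) (B S W : Finset (Fin d → ℤ))
    (hM : ∀ j, (B.filter fun b => b + u j ∉ B).card ≤ M) :
    ∑ v ∈ W, incrementBound u r B S v ≤ r * (B.card * edgeBdry u S) +
      (k * r) ^ 2 * ((stepSums u r).card * (k * (4 * M * edgeBdry u S))) := by
  simp only [incrementBound, Finset.sum_add_distrib, ← Finset.mul_sum]
  refine add_le_add (mul_le_mul_of_nonneg_left ?_ (Nat.cast_nonneg r))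
    (mul_le_mul_of_nonneg_left ?_ (by positivity))
  · rw [Finset.sum_comm, edgeBdry, Nat.cast_sum, Finset.mul_sum]
    exact Finset.sum_le_sum fun i _ => sum_max_repCount_sub_le B S W (u i)
  · simp only [repCountVariation]
    rw [Finset.sum_comm]
    refine (Finset.sum_le_card_nsmul _ _ (k * (4 * M * edgeBdry u S) : ℤ) fun z _ => ?_).trans
      (by simp)
    rw [sum_sub_eq_sum_image W z fun v => ∑ i, ∑ j, |repCountDiff B S (u i) (u j) v|,
      Finset.sum_comm]
    calc ∑ i, ∑ v ∈ W.image (· - z), ∑ j, |repCountDiff B S (u i) (u j) v|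
        ≤ ∑ i, (k * (4 * M * (S.filter fun v => v + u i ∉ S).card) : ℤ) := by
          refine Finset.sum_le_sum fun i _ => ?_
          rw [Finset.sum_comm]
          refine (Finset.sum_le_card_nsmul _ _
            (4 * M * (S.filter fun v => v + u i ∉ S).card : ℤ) fun j _ => ?_).trans (by simp)
          refine (sum_abs_repCountDiff_le B S _ (u i) (u j)).trans ?_
          gcongr
          exact_mod_cast hM j
      _ = _ := by
          rw [edgeBdry, Nat.cast_sum]
          simp only [Finset.mul_sum]

theorem exists_card_filter_add_notMem_le {u : Fin k → Fin d → ℤ}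
    (hgen : AddSubgroup.closure (Set.range u) = ⊤) (x : Fin d → ℤ) :
    ∃ K : ℕ, ∀ S : Finset (Fin d → ℤ),
      (S.filter fun v => v + x ∉ S).card ≤ K * edgeBdry u S := by
  have hx : x ∈ AddSubgroup.closure (Set.range u) := hgen ▸ AddSubgroup.mem_top x
  induction hx using AddSubgroup.closure_induction with
  | mem x hx =>
    obtain ⟨i, rfl⟩ := hx
    refine ⟨1, fun S => ?_⟩
    rw [one_mul]
    exact Finset.single_le_sum (f := fun i => (S.filter fun v => v + u i ∉ S).card)
      (fun _ _ => Nat.zero_le _) (Finset.mem_univ i)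
  | zero => exact ⟨0, fun S => by simp⟩
  | add x y _ _ hx hy =>
    obtain ⟨K, hK⟩ := hx
    obtain ⟨L, hL⟩ := hy
    refine ⟨K + L, fun S => ?_⟩
    rw [add_mul]
    refine le_trans ?_ (add_le_add (hK S) (hL S))
    calc (S.filter fun v => v + (x + y) ∉ S).card
        ≤ ((S.filter fun v => v + x ∉ S) ∪
            (S.filter fun v => v + y ∉ S).image (· - x)).card := by
          refine Finset.card_le_card fun v hv => ?_
          rw [Finset.mem_filter] at hv
          by_cases h : v + x ∈ S
          · refine Finset.mem_union_right _ (Finset.mem_image.2 ⟨v + x, ?_, by simp⟩)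
            rw [Finset.mem_filter, add_assoc]
            exact ⟨h, hv.2⟩
          · exact Finset.mem_union_left _ (Finset.mem_filter.2 ⟨hv.1, h⟩)
      _ ≤ _ := (Finset.card_union_le _ _).trans (Nat.add_le_add_left Finset.card_image_le _)
  | neg x _ hx =>
    obtain ⟨K, hK⟩ := hx
    refine ⟨K, fun S => ?_⟩
    simpa only [← sub_eq_add_neg, card_filter_sub_notMem] using hK S

/-- Large boxes in `ℤ^d` are almost invariant under translations by `u i`. -/
theorem exists_almost_invariant (hd : 1 ≤ d) (u : Fin k → Fin d → ℤ) {ε : ℝ} (hε : 0 < ε)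
    (M : ℝ) : ∃ B : Finset (Fin d → ℤ), B.Nonempty ∧ M ≤ B.card ∧
      ∀ i, ((B.filter fun b => b + u i ∉ B).card : ℝ) ≤ ε * B.card := by
  obtain ⟨m, hm⟩ : ∃ m : ℕ, ∀ i j, |u i j| ≤ m := by
    refine ⟨∑ i, ∑ j, (u i j).natAbs, fun i j => ?_⟩
    rw [Int.abs_eq_natAbs]
    norm_cast
    exact (Finset.single_le_sum (f := fun j => (u i j).natAbs) (fun _ _ => Nat.zero_le _)
      (Finset.mem_univ j)).trans (Finset.single_le_sum (f := fun i => ∑ j, (u i j).natAbs)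
      (fun _ _ => Nat.zero_le _) (Finset.mem_univ i))
  obtain ⟨R, hR⟩ := exists_nat_ge (max M (max (2 * m) (2 * m * d / ε)))
  have hRM : M ≤ R := (le_max_left _ _).trans hR
  have hR2m : 2 * m ≤ R := by
    have h : (2 * m : ℝ) ≤ R := (le_max_left _ _).trans ((le_max_right _ _).trans hR)
    exact_mod_cast h
  have hRε : (2 * m * d / ε : ℝ) ≤ R := (le_max_right _ _).trans ((le_max_right _ _).trans hR)
  have hcard : (Finset.Icc (0 : Fin d → ℤ) (fun _ => (R : ℤ))).card = (R + 1) ^ d := by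
    rw [Pi.card_Icc]
    simp only [Pi.zero_apply, Int.card_Icc, Finset.prod_const, Finset.card_univ, Fintype.card_fin]
    congr 1
  refine ⟨Finset.Icc 0 fun _ => (R : ℤ), ⟨0, by simp [Pi.le_def]⟩, ?_, fun i => ?_⟩
  · rw [hcard]
    have : R + 1 ≤ (R + 1) ^ d := Nat.le_self_pow (by omega) _
    have : (R + 1 : ℝ) ≤ ((R + 1) ^ d : ℕ) := by exact_mod_cast this
    linarith
  · set I : Finset (Fin d → ℤ) := Finset.Icc (fun _ => (m : ℤ)) (fun _ => (R - m : ℤ)) with hI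
    have hcardI : I.card = (R - 2 * m + 1) ^ d := by
      rw [hI, Pi.card_Icc]
      simp only [Int.card_Icc, Finset.prod_const, Finset.card_univ, Fintype.card_fin]
      congr 1
      omega
    have hsub : I ⊆ Finset.Icc 0 fun _ => (R : ℤ) := by
      refine Finset.Icc_subset_Icc (fun j => ?_) (fun j => ?_) <;> simp
    have hle : ((Finset.Icc (0 : Fin d → ℤ) fun _ => (R : ℤ)).filter fun b =>
        b + u i ∉ Finset.Icc (0 : Fin d → ℤ) fun _ => (R : ℤ)).card ≤
        (R + 1) ^ d - (R - 2 * m + 1) ^ d := by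
      rw [← hcard, ← hcardI, ← Finset.card_sdiff_of_subset hsub]
      refine Finset.card_le_card fun v hv => ?_
      rw [Finset.mem_filter] at hv
      refine Finset.mem_sdiff.2 ⟨hv.1, fun hvI => hv.2 ?_⟩
      rw [hI, Finset.mem_Icc] at hvI
      rw [Finset.mem_Icc]
      refine ⟨fun j => ?_, fun j => ?_⟩
      · have h1 := hvI.1 j
        have h2 := abs_le.1 (hm i j)
        simp only [Pi.zero_apply, Pi.add_apply] at h1 ⊢
        linarith
      · have h1 := hvI.2 j
        have h2 := abs_le.1 (hm i j)
        simp only [Pi.add_apply] at h1 ⊢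
        linarith
    have hpow : ((R - 2 * m + 1 : ℕ) : ℝ) ^ d ≥ (R + 1) ^ d * (1 - ε) := by
      have hR1 : (0 : ℝ) < R + 1 := by positivity
      have hquot : (2 * m : ℝ) / (R + 1) ≤ 1 := by
        rw [div_le_one hR1]
        have : (2 * m : ℝ) ≤ R := by exact_mod_cast hR2m
        linarith
      have h := one_add_mul_le_pow (a := -((2 * m : ℝ) / (R + 1))) (by linarith) d
      have h2 : ((R - 2 * m + 1 : ℕ) : ℝ) ^ d =
          (R + 1) ^ d * (1 + -((2 * m : ℝ) / (R + 1))) ^ d := by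
        rw [← mul_pow]
        congr 1
        push_cast [hR2m]
        field_simp
        ring
      rw [h2]
      refine mul_le_mul_of_nonneg_left (le_trans ?_ h) (by positivity)
      have h3 : (d : ℝ) * (2 * m / (R + 1)) ≤ ε := by
        rw [div_le_iff₀ hε] at hRε
        rw [← mul_div_assoc, div_le_iff₀ hR1]
        nlinarith
      linarith
    rw [hcard]
    have hle' : (((Finset.Icc (0 : Fin d → ℤ) fun _ => (R : ℤ)).filter fun b =>
        b + u i ∉ Finset.Icc (0 : Fin d → ℤ) fun _ => (R : ℤ)).card : ℝ) ≤
        ((R + 1) ^ d : ℝ) - ((R - 2 * m + 1 : ℕ) : ℝ) ^ d := by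
      have h4 : (R - 2 * m + 1) ^ d ≤ (R + 1) ^ d := Nat.pow_le_pow_left (by omega) d
      calc _ ≤ (((R + 1) ^ d - (R - 2 * m + 1) ^ d : ℕ) : ℝ) := by exact_mod_cast hle
        _ = _ := by rw [Nat.cast_sub h4]; push_cast; rfl
    push_cast
    linarith

end Growth

/-- Asymptotic comparison of a multiple of `n ^ (1 - 1 / d)` with `n`. -/
theorem eventually_mul_rpow_le {d : ℕ} (hd : 1 ≤ d) (Q : ℝ) {c : ℝ} (hc : 0 < c) :
    ∃ n₀ : ℕ, 1 ≤ n₀ ∧ ∀ n : ℕ, n₀ ≤ n → Q * (n : ℝ) ^ (1 - (1 : ℝ) / d) ≤ c * n := by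
  have hd0 : (0 : ℝ) < 1 / d := by
    have : (0 : ℝ) < d := by exact_mod_cast hd
    positivity
  have h := ((tendsto_rpow_atTop hd0).comp tendsto_natCast_atTop_atTop).eventually_ge_atTop (Q / c)
  obtain ⟨n₀, hn₀⟩ := Filter.eventually_atTop.1 h
  refine ⟨max n₀ 1, le_max_right _ _, fun n hn => ?_⟩
  have hn1 : (0 : ℝ) < n := by exact_mod_cast (le_max_right _ _).trans hn
  have h1 := hn₀ n ((le_max_left _ _).trans hn)
  simp only [Function.comp_apply, div_le_iff₀ hc] at h1
  have h2 : (n : ℝ) = (n : ℝ) ^ (1 / d : ℝ) * (n : ℝ) ^ (1 - 1 / d : ℝ) := by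
    rw [← Real.rpow_add hn1]; simp
  calc Q * (n : ℝ) ^ (1 - (1 : ℝ) / d)
      ≤ (n : ℝ) ^ (1 / d : ℝ) * c * (n : ℝ) ^ (1 - 1 / d : ℝ) :=
        mul_le_mul_of_nonneg_right h1 (by positivity)
    _ = c * ((n : ℝ) ^ (1 / d : ℝ) * (n : ℝ) ^ (1 - 1 / d : ℝ)) := by ring
    _ = c * n := by rw [← h2]

/-- A set with small edge boundary has large level sets. -/
theorem le_card_level {d k : ℕ} {u : Fin k → Fin d → ℤ} {B S : Finset (Fin d → ℤ)} {K : ℕ}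
    (hB : B.Nonempty) (hK : ∀ b ∈ B, (S.filter fun v => v + b ∉ S).card ≤ K * edgeBdry u S)
    {η : ℝ} (hη : 0 < η) {j : ℤ} (hj : 1 ≤ j) (hjB : (j : ℝ) ≤ (1 - η) * B.card)
    (hS : (K * edgeBdry u S : ℝ) ≤ η ^ 2 * S.card) :
    (1 - η) * S.card ≤ ((level B S j).card : ℝ) := by
  have h1 : ((S \ level B S j).card : ℝ) * (B.card - j) ≤ B.card * (K * edgeBdry u S) := by
    have h := (card_sdiff_level_mul_le B S hj).trans
      (Finset.sum_le_card_nsmul B _ (K * edgeBdry u S : ℤ) fun b hb => by exact_mod_cast hK b hb)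
    rw [nsmul_eq_mul] at h
    exact_mod_cast h
  have hN : (0 : ℝ) < B.card := by exact_mod_cast hB.card_pos
  have h2 : ((S \ level B S j).card : ℝ) ≤ η * S.card := by
    have h3 : ((S \ level B S j).card : ℝ) * (η * B.card) ≤ (η * S.card) * (η * B.card) :=
      calc ((S \ level B S j).card : ℝ) * (η * B.card)
          ≤ ((S \ level B S j).card : ℝ) * (B.card - j) :=
            mul_le_mul_of_nonneg_left (by linarith) (Nat.cast_nonneg _)
        _ ≤ B.card * (η ^ 2 * S.card) := h1.trans (mul_le_mul_of_nonneg_left hS hN.le)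
        _ = _ := by ring
    exact le_of_mul_le_mul_right h3 (by positivity)
  have h4 : (S.card : ℝ) ≤ (S \ level B S j).card + (level B S j).card := by
    exact_mod_cast Finset.card_le_card_sdiff_add_card
  linarith

/-- A summand that is at least `Y` on most of an interval has a large sum over it. -/
theorem mul_le_sum_Icc {N : ℕ} {η Y : ℝ} {f : ℤ → ℝ} (hη0 : 0 < η) (hη1 : η ≤ 1)
    (hN : 1 / η ≤ N) (hY : 0 ≤ Y) (hf : ∀ j : ℤ, 1 ≤ j → (j : ℝ) ≤ (1 - η) * N → Y ≤ f j)
    (hf0 : ∀ j, 0 ≤ f j) :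
    (1 - 2 * η) * N * Y ≤ ∑ j ∈ Finset.Icc (1 : ℤ) N, f j := by
  have hN0 : (0 : ℝ) ≤ N := Nat.cast_nonneg _
  set J : ℤ := ⌊(1 - η) * N⌋ with hJ
  have hJ0 : 0 ≤ J := Int.floor_nonneg.2 (mul_nonneg (by linarith) hN0)
  have hJle : (J : ℝ) ≤ (1 - η) * N := Int.floor_le _
  have hJN : J ≤ N := by
    have : (J : ℝ) ≤ N := hJle.trans (mul_le_of_le_one_left hN0 (by linarith))
    exact_mod_cast this
  have hJge : (1 - 2 * η) * N ≤ J := by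
    have h1 := Int.lt_floor_add_one ((1 - η) * (N : ℝ))
    rw [div_le_iff₀ hη0] at hN
    rw [← hJ] at h1
    linarith
  calc (1 - 2 * η) * N * Y ≤ J * Y := mul_le_mul_of_nonneg_right hJge hY
    _ = ∑ _j ∈ Finset.Icc 1 J, Y := by
        rw [Finset.sum_const, Int.card_Icc, add_sub_cancel_right, nsmul_eq_mul]
        congr 1
        exact_mod_cast (Int.toNat_of_nonneg hJ0).symm
    _ ≤ ∑ j ∈ Finset.Icc 1 J, f j :=
        Finset.sum_le_sum fun j hj => hf j (Finset.mem_Icc.1 hj).1 <|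
          le_trans (by exact_mod_cast (Finset.mem_Icc.1 hj).2) hJle
    _ ≤ _ := Finset.sum_le_sum_of_subset_of_nonneg (Finset.Icc_subset_Icc_right hJN)
        fun j _ _ => hf0 j

theorem mul_rpow_le_rpow {d : ℕ} (hd : 1 ≤ d) {a x y : ℝ} (ha0 : 0 < a) (ha1 : a ≤ 1)
    (hx : 0 ≤ x) (h : a * x ≤ y) :
    a * x ^ (1 - (1 : ℝ) / d) ≤ y ^ (1 - (1 : ℝ) / d) := by
  have hdR : (1 : ℝ) ≤ d := by exact_mod_cast hd
  have hdpos : (0 : ℝ) < 1 / d := by positivity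
  have hexp : (0 : ℝ) ≤ 1 - 1 / d := by
    rw [sub_nonneg, div_le_one (by linarith)]; exact hdR
  calc a * x ^ (1 - (1 : ℝ) / d)
      ≤ a ^ (1 - (1 : ℝ) / d) * x ^ (1 - (1 : ℝ) / d) := by
        refine mul_le_mul_of_nonneg_right ?_ (by positivity)
        conv_lhs => rw [← Real.rpow_one a]
        exact Real.rpow_le_rpow_of_exponent_ge ha0 ha1 (by linarith)
    _ = (a * x) ^ (1 - (1 : ℝ) / d) := (Real.mul_rpow ha0.le hx).symm
    _ ≤ _ := Real.rpow_le_rpow (by positivity) h hexp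

/-- If `B` is almost invariant under the generators, then the total growth of the level sets is
controlled by the edge boundary. -/
theorem sum_card_level_growth_le {d k s : ℕ} {u : Fin k → Fin d → ℤ} {B : Finset (Fin d → ℤ)}
    (S : Finset (Fin d → ℤ)) {η : ℝ} (hη : 0 < η)
    (hB : ∀ j, ((B.filter fun b => b + u j ∉ B).card : ℝ) ≤
      η / ((k * s) ^ 2 * ((stepSums u s).card * (k * 4)) + 1) * B.card) :
    (∑ j ∈ Finset.Icc (1 : ℤ) B.card,
      (((level B S j + stepSums u s).card : ℝ) - (level B S j).card)) ≤
      B.card * (s + η) * edgeBdry u S := by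
  set C : ℝ := (k * s) ^ 2 * ((stepSums u s).card * (k * 4)) with hC
  have hC0 : 0 ≤ C := by positivity
  obtain ⟨M, hM⟩ : ∃ M : ℕ, M = Finset.univ.sup fun j =>
    (B.filter fun b => b + u j ∉ B).card := ⟨_, rfl⟩
  have hMle : ∀ j, (B.filter fun b => b + u j ∉ B).card ≤ M := fun j => by
    rw [hM]
    exact Finset.le_sup (f := fun j => (B.filter fun b => b + u j ∉ B).card) (Finset.mem_univ j)
  have hMε : (M : ℝ) ≤ η / (C + 1) * B.card := by
    rw [hM]
    refine Finset.sup_induction (p := fun m : ℕ => (m : ℝ) ≤ η / (C + 1) * B.card)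
      (by simp; positivity) (fun a ha b hb => ?_) fun j _ => hB j
    rcases max_choice a b with h | h <;> simpa [h] using by assumption
  have h := (sum_card_level_add_sub_le B S (stepSums u s) B.card (incrementBound u s B S)
    (incrementBound_nonneg u s B S)
    (fun v z hz => repCount_sub_le_add_incrementBound u B S v hz)
    (zero_mem_stepSums u s)).trans (sum_incrementBound_le u s M B S _ hMle)
  have hcast : (∑ j ∈ Finset.Icc (1 : ℤ) B.card,
      (((level B S j + stepSums u s).card : ℝ) - (level B S j).card)) ≤
      s * (B.card * edgeBdry u S) +
        (k * s) ^ 2 * ((stepSums u s).card * (k * (4 * M * edgeBdry u S))) := by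
    exact_mod_cast h
  have hCM : C * M ≤ η * B.card := by
    have h5 : C * (η / (C + 1)) ≤ η := by
      rw [← mul_div_assoc, div_le_iff₀ (by linarith)]
      nlinarith
    calc C * M ≤ C * (η / (C + 1) * B.card) := mul_le_mul_of_nonneg_left hMε hC0
      _ = C * (η / (C + 1)) * B.card := by ring
      _ ≤ η * B.card := mul_le_mul_of_nonneg_right h5 (Nat.cast_nonneg _)
  have h6 := mul_le_mul_of_nonneg_right hCM (Nat.cast_nonneg (α := ℝ) (edgeBdry u S))
  calc _ ≤ _ := hcast
    _ = s * (B.card * edgeBdry u S) + C * M * edgeBdry u S := by rw [hC]; ring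
    _ ≤ _ := by linarith

theorem edge_iso_lower_bound (d k : ℕ) (hd : 1 ≤ d)
    (u : Fin k → (Fin d → ℤ)) (hu : ∀ i, u i ≠ 0)
    (hgen : AddSubgroup.closure (Set.range u) = ⊤)
    (Z0 : Finset (Fin d → ℤ))
    (hZ0 : Z0 = ∑ i, ({0, u i} : Finset (Fin d → ℤ)))
    (Z : Set (Fin d → ℝ))
    (hZ : Z = convexHull ℝ (toReal' '' (Z0 : Set (Fin d → ℤ))))
    (δ : ℝ) (hδ : 0 < δ) :
    ∃ n₀ : ℕ, ∀ n : ℕ, n₀ ≤ n → ∀ S : Finset (Fin d → ℤ), S.card = n →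
      (1 - δ) * d * (volume Z).toReal ^ ((1 : ℝ) / d) * (n : ℝ) ^ (1 - (1 : ℝ) / d)
        ≤ (edgeBdry u S : ℝ) := by
  subst hZ0
  have hdR : (1 : ℝ) ≤ d := by exact_mod_cast hd
  have hdpos : (0 : ℝ) < 1 / d := by positivity
  by_cases hδ1 : 1 ≤ δ
  · refine ⟨0, fun n _ S _ => le_trans ?_ (Nat.cast_nonneg _)⟩
    rw [mul_assoc, mul_assoc]
    exact mul_nonpos_of_nonpos_of_nonneg (by linarith) (by positivity)
  by_cases hZvol : volume Z = 0
  · refine ⟨0, fun n _ S _ => le_trans ?_ (Nat.cast_nonneg _)⟩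
    rw [hZvol, ENNReal.toReal_zero, Real.zero_rpow hdpos.ne']
    simp
  push Not at hδ1
  set V := (volume Z).toReal ^ ((1 : ℝ) / d) with hV
  have hV0 : 0 ≤ V := by positivity
  set η := δ / 5 with hη
  have hη0 : 0 < η := by positivity
  have hη1 : η < 1 / 5 := by linarith
  obtain ⟨q, hq⟩ := exists_card_add_stepSums_ge hd hgen hZ hZvol
  obtain ⟨r, hr⟩ := exists_nat_ge (max 1 (q / η))
  have hr1 : (1 : ℝ) ≤ r := (le_max_left _ _).trans hr
  have hrq : (q : ℝ) ≤ η * r := by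
    have := (le_max_right _ _).trans hr
    rwa [div_le_iff₀' hη0] at this
  set s := r + q with hs
  obtain ⟨B, hBne, hBcard, hBinv⟩ :=
    exists_almost_invariant hd u
    (ε := η / ((k * s) ^ 2 * ((stepSums u s).card * (k * 4)) + 1)) (by positivity) (1 / η)
  have hN : (0 : ℝ) < B.card := by exact_mod_cast hBne.card_pos
  choose K hK using exists_card_filter_add_notMem_le hgen
  obtain ⟨n₀, hn₀1, hn₀⟩ := eventually_mul_rpow_le hd ((∑ b ∈ B, K b : ℕ) * (d * V))
    (c := η ^ 2) (by positivity)
  refine ⟨n₀, fun n hn S hSn => ?_⟩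
  have hn0 : (0 : ℝ) < n := by exact_mod_cast hn₀1.trans hn
  set X := d * V * (n : ℝ) ^ (1 - (1 : ℝ) / d) with hX
  have hX0 : 0 ≤ X := by positivity
  have hgoal : (1 - δ) * d * V * (n : ℝ) ^ (1 - (1 : ℝ) / d) = (1 - δ) * X := by rw [hX]; ring
  rw [hgoal]
  by_contra! hlt
  have hbX : (edgeBdry u S : ℝ) ≤ X := hlt.le.trans (mul_le_of_le_one_left hX0 (by linarith))
  have hKS : ((∑ b ∈ B, K b : ℕ) * edgeBdry u S : ℝ) ≤ η ^ 2 * S.card := by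
    rw [hSn]
    refine le_trans (mul_le_mul_of_nonneg_left hbX (Nat.cast_nonneg _)) (le_trans (le_of_eq ?_)
      (hn₀ n hn))
    rw [hX]; ring
  have hlevel : ∀ j : ℤ, 1 ≤ j → (j : ℝ) ≤ (1 - η) * B.card →
      (1 - η) * n ≤ ((level B S j).card : ℝ) := fun j hj hjB => by
    rw [← hSn]
    refine le_card_level hBne (fun b hb => (hK b S).trans (Nat.mul_le_mul_right _ ?_)) hη0 hj hjB hKS
    exact Finset.single_le_sum (f := K) (fun _ _ => Nat.zero_le _) hb
  have hgrow : ∀ j : ℤ, 1 ≤ j → (j : ℝ) ≤ (1 - η) * B.card →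
      r * ((1 - η) * X) ≤ (((level B S j + stepSums u s).card : ℝ) - (level B S j).card) := by
    intro j hj hjB
    have h1 := hlevel j hj hjB
    have hne : (level B S j).Nonempty := by
      rw [← Finset.card_pos]
      have : (0 : ℝ) < (level B S j).card := lt_of_lt_of_le (mul_pos (by linarith) hn0) h1
      exact_mod_cast this
    have h2 := hq r (by exact_mod_cast hr1) _ hne
    have h3 := mul_rpow_le_rpow hd (by linarith) (by linarith) hn0.le h1
    have h4 : (r : ℝ) * ((1 - η) * X) ≤
        r * (d * V * ((level B S j).card : ℝ) ^ (1 - (1 : ℝ) / d)) := by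
      refine mul_le_mul_of_nonneg_left ?_ (by linarith)
      calc (1 - η) * X = d * V * ((1 - η) * (n : ℝ) ^ (1 - (1 : ℝ) / d)) := by rw [hX]; ring
        _ ≤ _ := mul_le_mul_of_nonneg_left h3 (by positivity)
    linarith
  have hupper := sum_card_level_growth_le S hη0 hBinv
  have hlower : (1 - 2 * η) * B.card * (r * ((1 - η) * X)) ≤
      ∑ j ∈ Finset.Icc (1 : ℤ) B.card,
        (((level B S j + stepSums u s).card : ℝ) - (level B S j).card) := by
    refine mul_le_sum_Icc hη0 (by linarith) hBcard
      (mul_nonneg (by linarith) (mul_nonneg (by linarith) hX0)) hgrow fun j => sub_nonneg.2 ?_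
    exact_mod_cast Finset.card_le_card_add_right ⟨0, zero_mem_stepSums u s⟩
  have hsr : (s : ℝ) + η ≤ r * (1 + 2 * η) := by
    have : η * 1 ≤ η * r := mul_le_mul_of_nonneg_left hr1 hη0.le
    rw [hs]; push_cast; linarith
  have hb0 : (0 : ℝ) ≤ edgeBdry u S := Nat.cast_nonneg _
  have hfinal : (B.card * r : ℝ) * ((1 - 2 * η) * (1 - η) * X) ≤
      (B.card * r) * ((1 + 2 * η) * edgeBdry u S) :=
    calc (B.card * r : ℝ) * ((1 - 2 * η) * (1 - η) * X)
        = (1 - 2 * η) * B.card * (r * ((1 - η) * X)) := by ring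
      _ ≤ B.card * (s + η) * edgeBdry u S := hlower.trans hupper
      _ ≤ B.card * (r * (1 + 2 * η)) * edgeBdry u S := by gcongr
      _ = _ := by ring
  have hcancel := le_of_mul_le_mul_left hfinal (by positivity)
  have hXpos : 0 < X := by
    by_contra! h
    have : X = 0 := le_antisymm h hX0
    rw [this] at hlt
    linarith
  have hcoef : (1 + 2 * η) * (1 - δ) ≤ (1 - 2 * η) * (1 - η) := by
    have : δ = 5 * η := by rw [hη]; ring
    rw [this]
    nlinarith [sq_nonneg η]
  have h7 : (1 + 2 * η) * edgeBdry u S < (1 + 2 * η) * ((1 - δ) * X) :=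
    mul_lt_mul_of_pos_left hlt (by linarith)
  have h8 := mul_le_mul_of_nonneg_right hcoef hX0
  linarith
end

section
/- Let d ≥ 1 and let U = {u_1, …, u_k} be a finite set of non-zero vectors in ℤ^d that generate ℤ^d as a group. Let Z_0 = {0,u_1} + ⋯ + {0,u_k} and let Z be the convex hull of Z_0 in ℝ^d. Then for every δ > 0 there exists n_0 such that for every n ≥ n_0 there is a finite set S ⊆ ℤ^d with |S| = n and edge boundary ∂(S) ≤ (1+δ) d vol(Z)^{1/d} n^{1−1/d}. -/
open Pointwise MeasureTheory

open Filter Topology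

lemma succ_pow_le_add (s d : ℕ) : (s + 1) ^ d ≤ s ^ d + d * (s + 1) ^ (d - 1) := by
  have h := abs_pow_sub_pow_le ((s : ℤ) + 1) s d
  rw [add_sub_cancel_left, abs_one, one_mul, abs_of_nonneg (a := (s : ℤ) + 1) (by positivity),
    abs_of_nonneg (a := (s : ℤ)) (by positivity), max_eq_left (by omega)] at h
  have h' := (le_abs_self _).trans h
  zify
  linarith

/-- The number of lines in direction `w` meeting `A` is at most that for `B ⊇ A`, and extending each
line of `B` by `s` further points produces that many new points `s` times over. -/
lemma mul_card_filter_add_notMem_le {G : Type*} [AddCommGroup G] [IsAddTorsionFree G]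
    [DecidableEq G] {w : G} (hw : w ≠ 0) {A B C : Finset G} {s : ℕ}
    (hA : ∀ v ∈ A, ∀ m : ℕ, 1 ≤ m → v + m • w ∈ A → v + w ∈ A) (hAB : A ⊆ B)
    (hBC : ∀ v ∈ B, ∀ r ≤ s, v + r • w ∈ C) :
    s * (A.filter fun v => v + w ∉ A).card + B.card ≤ C.card := by
  have hinj : Function.Injective fun n : ℕ => n • w :=
    injective_nsmul_iff_not_isOfFinAddOrder.2 (not_isOfFinAddOrder_of_isAddTorsionFree hw)
  have hlast : ∀ v ∈ A, ∃ m : ℕ, v + m • w ∈ B ∧ ∀ m', m < m' → v + m' • w ∉ B := by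
    intro v hv
    have hfin : {m : ℕ | v + m • w ∈ B}.Finite :=
      Set.Finite.preimage (f := fun m : ℕ => v + m • w)
        (fun a _ b _ hab => hinj (add_left_cancel hab)) B.finite_toSet
    obtain ⟨m, hm, hmax⟩ := hfin.exists_maximal ⟨0, by simpa using hAB hv⟩
    exact ⟨m, hm, fun m' hlt hm' => absurd (hmax hm' hlt.le) (by simpa using hlt)⟩
  choose! last hlastB hlast using hlast
  set E := A.filter fun v => v + w ∉ A
  have hEmem : ∀ v ∈ E, v ∈ A ∧ v + w ∉ A := fun v hv => Finset.mem_filter.1 hv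
  have hsame : ∀ v ∈ E, ∀ v' ∈ E, ∀ a b : ℕ, a ≤ b → v + b • w = v' + a • w → v = v' := by
    intro v hv v' hv' a b hab h
    obtain ⟨c, rfl⟩ := Nat.exists_eq_add_of_le hab
    have h1 : v + c • w = v' := by
      rw [add_smul, add_comm (a • w), ← add_assoc] at h
      exact add_right_cancel h
    rcases Nat.eq_zero_or_pos c with rfl | hc
    · simpa using h1
    · exact absurd (hA v (hEmem v hv).1 c hc (h1 ▸ (hEmem v' hv').1)) (hEmem v hv).2
  let f : G × ℕ → G := fun p => p.1 + (last p.1 + (p.2 + 1)) • w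
  have hf : Set.InjOn f (E ×ˢ Finset.range s : Finset (G × ℕ)) := by
    rintro ⟨v, r⟩ hp ⟨v', r'⟩ hp' h
    simp only [Finset.coe_product, Set.mem_prod, Finset.mem_coe] at hp hp'
    have hvv : v = v' := by
      rcases le_total (last v + (r + 1)) (last v' + (r' + 1)) with hle | hle
      · exact (hsame v' hp'.1 v hp.1 _ _ hle h.symm).symm
      · exact hsame v hp.1 v' hp'.1 _ _ hle h
    subst hvv
    have : last v + (r + 1) = last v + (r' + 1) := hinj (add_left_cancel h)
    simp only [Prod.mk.injEq, true_and]
    omega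
  have hdisj : Disjoint ((E ×ˢ Finset.range s).image f) B := by
    rw [Finset.disjoint_left]
    intro x hx hxB
    obtain ⟨⟨v, r⟩, hp, rfl⟩ := Finset.mem_image.1 hx
    exact hlast v (hEmem v (Finset.mem_product.1 hp).1).1 (last v + (r + 1)) (by omega) hxB
  have hsub : (E ×ˢ Finset.range s).image f ∪ B ⊆ C := by
    intro x hx
    rcases Finset.mem_union.1 hx with hx | hx
    · obtain ⟨⟨v, r⟩, hp, rfl⟩ := Finset.mem_image.1 hx
      obtain ⟨hv, hr⟩ := Finset.mem_product.1 hp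
      simp only [f]
      rw [add_smul, ← add_assoc]
      exact hBC _ (hlastB v (hEmem v hv).1) _ (by simpa using hr)
    · simpa using hBC x hx 0 (Nat.zero_le _)
  calc s * E.card + B.card = ((E ×ˢ Finset.range s).image f ∪ B).card := by
        rw [Finset.card_union_of_disjoint hdisj, Finset.card_image_of_injOn hf,
          Finset.card_product, Finset.card_range, mul_comm]
    _ ≤ C.card := Finset.card_le_card hsub

lemma edgeBdry_union_le {d k : ℕ} (u : Fin k → Fin d → ℤ) (A B : Finset (Fin d → ℤ)) :
    edgeBdry u (A ∪ B) ≤ edgeBdry u A + edgeBdry u B := by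
  unfold edgeBdry
  rw [← Finset.sum_add_distrib]
  refine Finset.sum_le_sum fun i _ => (Finset.card_le_card ?_).trans (Finset.card_union_le _ _)
  intro v
  simp only [Finset.mem_filter, Finset.mem_union]
  tauto

lemma edgeBdry_map_addRight {d k : ℕ} (u : Fin k → Fin d → ℤ) (A : Finset (Fin d → ℤ))
    (x : Fin d → ℤ) : edgeBdry u (A.map (addRightEmbedding x)) = edgeBdry u A := by
  unfold edgeBdry
  refine Finset.sum_congr rfl fun i _ => ?_
  rw [Finset.filter_map, Finset.card_map]
  congr 1
  refine Finset.filter_congr fun v _ => ?_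
  rw [Function.comp_apply, show addRightEmbedding x v + u i = addRightEmbedding x (v + u i) by
    simp [add_right_comm], Finset.mem_map' (addRightEmbedding x)]

lemma edgeBdry_le_mul_card {d k : ℕ} (u : Fin k → Fin d → ℤ) (A : Finset (Fin d → ℤ)) :
    edgeBdry u A ≤ k * A.card := by
  unfold edgeBdry
  refine (Finset.sum_le_sum fun i _ => Finset.card_filter_le A _).trans ?_
  simp

/-- The minimal edge boundary is subadditive in the cardinality. -/
lemma exists_card_add_edgeBdry_le {d k : ℕ} (hd : 1 ≤ d) (u : Fin k → Fin d → ℤ)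
    (A B : Finset (Fin d → ℤ)) :
    ∃ S : Finset (Fin d → ℤ), S.card = A.card + B.card ∧
      edgeBdry u S ≤ edgeBdry u A + edgeBdry u B := by
  have : Nonempty (Fin d) := ⟨⟨0, hd⟩⟩
  obtain ⟨x, hx⟩ := Infinite.exists_notMem_finset (A - B)
  have hdisj : Disjoint A (B.map (addRightEmbedding x)) := by
    rw [Finset.disjoint_left]
    intro a ha hab
    obtain ⟨b, hb, rfl⟩ := Finset.mem_map.1 hab
    exact hx (Finset.mem_sub.2 ⟨_, ha, b, hb, by simp⟩)
  refine ⟨A ∪ B.map (addRightEmbedding x), ?_, ?_⟩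
  · rw [Finset.card_union_of_disjoint hdisj, Finset.card_map]
  · exact (edgeBdry_union_le u _ _).trans_eq (by rw [edgeBdry_map_addRight])

lemma exists_card_eq {d : ℕ} (hd : 1 ≤ d) (m : ℕ) : ∃ S : Finset (Fin d → ℤ), S.card = m := by
  have : Nonempty (Fin d) := ⟨⟨0, hd⟩⟩
  exact Infinite.exists_subset_card_eq _ m

/-- The discrete cube of side `s`. -/
noncomputable def discreteCube (d s : ℕ) : Finset (Fin d → ℤ) :=
  Fintype.piFinset fun _ => Finset.Ico 0 (s : ℤ)

lemma card_discreteCube (d s : ℕ) : (discreteCube d s).card = s ^ d := by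
  simp [discreteCube]

lemma card_Ico_filter_add_notMem_le (s : ℕ) (c : ℤ) :
    ((Finset.Ico 0 (s : ℤ)).filter fun x => x + c ∉ Finset.Ico 0 (s : ℤ)).card ≤ c.natAbs := by
  rcases le_total 0 c with hc | hc
  · refine (Finset.card_le_card (t := Finset.Ico (s - c) (s : ℤ)) ?_).trans ?_
    · intro x
      simp only [Finset.mem_filter, Finset.mem_Ico]
      omega
    · rw [Int.card_Ico]; omega
  · refine (Finset.card_le_card (t := Finset.Ico 0 (-c)) ?_).trans ?_
    · intro x
      simp only [Finset.mem_filter, Finset.mem_Ico]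
      omega
    · rw [Int.card_Ico]; omega

lemma edgeBdry_discreteCube_le {d k : ℕ} (u : Fin k → Fin d → ℤ) (s : ℕ) :
    edgeBdry u (discreteCube d s) ≤ (∑ i, ∑ j, (u i j).natAbs) * s ^ (d - 1) := by
  unfold edgeBdry
  rw [Finset.sum_mul]
  refine Finset.sum_le_sum fun i _ => ?_
  rw [Finset.sum_mul]
  let F : Fin d → Finset (Fin d → ℤ) := fun j => Fintype.piFinset
    (Function.update (fun _ => Finset.Ico 0 (s : ℤ)) j
      ((Finset.Ico 0 (s : ℤ)).filter fun x => x + u i j ∉ Finset.Ico 0 (s : ℤ)))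
  have hsub : (discreteCube d s).filter (fun v => v + u i ∉ discreteCube d s) ⊆
      Finset.univ.biUnion F := by
    intro v hv
    simp only [discreteCube, Finset.mem_filter, Fintype.mem_piFinset, Pi.add_apply, not_forall]
      at hv
    obtain ⟨hv, j, hj⟩ := hv
    refine Finset.mem_biUnion.2 ⟨j, Finset.mem_univ _, Fintype.mem_piFinset.2 fun l => ?_⟩
    rcases eq_or_ne l j with rfl | hl
    · simp only [Function.update_self, Finset.mem_filter]
      exact ⟨hv _, hj⟩
    · simpa only [Function.update_of_ne hl] using hv l
  refine (Finset.card_le_card hsub).trans (Finset.card_biUnion_le.trans ?_)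
  refine Finset.sum_le_sum fun j _ => ?_
  have hcard : ∀ l, (Function.update (fun _ => Finset.Ico 0 (s : ℤ)) j
      ((Finset.Ico 0 (s : ℤ)).filter fun x => x + u i j ∉ Finset.Ico 0 (s : ℤ)) l).card =
      Function.update (fun _ => s) j
        (((Finset.Ico 0 (s : ℤ)).filter fun x => x + u i j ∉ Finset.Ico 0 (s : ℤ)).card) l := by
    intro l
    rcases eq_or_ne l j with rfl | hl
    · simp only [Function.update_self]
    · simp [Function.update_of_ne hl]
  simp only [F, Fintype.card_piFinset]
  rw [Finset.prod_congr rfl fun l _ => hcard l,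
    Finset.prod_update_of_mem (Finset.mem_univ j), Finset.prod_const]
  have : (Finset.univ \ {j}).card = d - 1 := by
    rw [Finset.card_sdiff_of_subset (Finset.subset_univ _)]; simp
  rw [this]
  exact Nat.mul_le_mul_right _ (card_Ico_filter_add_notMem_le s _)

/-- Sets of every size with edge boundary of the right order of magnitude. -/
lemma exists_edgeBdry_le_mul_rpow {d k : ℕ} (hd : 1 ≤ d) (u : Fin k → Fin d → ℤ) :
    ∃ C : ℝ, 0 ≤ C ∧ ∀ m : ℕ, ∃ S : Finset (Fin d → ℤ), S.card = m ∧
      (edgeBdry u S : ℝ) ≤ C * (m : ℝ) ^ (1 - (1 : ℝ) / d) := by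
  set K := ∑ i, ∑ j, (u i j).natAbs
  have hd0 : d ≠ 0 := by omega
  have hdR : (d : ℝ) ≠ 0 := by exact_mod_cast hd0
  have key : ∀ m : ℕ, ∃ S : Finset (Fin d → ℤ), S.card = m ∧ ∃ s : ℕ, s ^ d ≤ m ∧
      edgeBdry u S ≤ (K + k * (d * 2 ^ (d - 1))) * s ^ (d - 1) := by
    intro m
    have hex : ∃ s : ℕ, m < (s + 1) ^ d := ⟨m, (Nat.lt_succ_self m).trans_le
      (Nat.le_self_pow hd0 _)⟩
    set s := Nat.find hex
    have h1 : m < (s + 1) ^ d := Nat.find_spec hex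
    rcases Nat.eq_zero_or_pos m with rfl | hm
    · exact ⟨∅, rfl, 0, by simp [hd0], by simp [edgeBdry]⟩
    have h2 : s ^ d ≤ m := by
      rcases Nat.eq_zero_or_pos s with h0 | hpos
      · rw [h0]; simp [hd0]
      · have := Nat.find_min hex (m := s - 1) (by omega)
        rwa [Nat.sub_add_cancel hpos, not_lt] at this
    have hs1 : 1 ≤ s := by
      by_contra h
      have h0 : s = 0 := by omega
      rw [h0] at h1
      simp at h1
      omega
    obtain ⟨R, hR⟩ := exists_card_eq hd (m - s ^ d)
    obtain ⟨S, hS, hSb⟩ := exists_card_add_edgeBdry_le hd u (discreteCube d s) R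
    refine ⟨S, by rw [hS, card_discreteCube, hR]; omega, s, h2, hSb.trans ?_⟩
    have hgap : (s + 1) ^ d ≤ s ^ d + d * 2 ^ (d - 1) * s ^ (d - 1) := by
      refine (succ_pow_le_add s d).trans ?_
      rw [mul_assoc, ← mul_pow]
      gcongr
      omega
    rw [add_mul]
    refine add_le_add (edgeBdry_discreteCube_le u s) ((edgeBdry_le_mul_card u R).trans ?_)
    rw [hR, mul_assoc]
    exact Nat.mul_le_mul_left _ (by omega)
  refine ⟨(K + k * (d * 2 ^ (d - 1)) : ℕ), by positivity, fun m => ?_⟩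
  obtain ⟨S, hS, s, hs, hb⟩ := key m
  refine ⟨S, hS, ?_⟩
  have hpow : ((s : ℝ) ^ (d - 1)) ≤ (m : ℝ) ^ (1 - (1 : ℝ) / d) := by
    have h : ((s : ℝ) ^ d) ≤ m := by exact_mod_cast hs
    have he : 0 ≤ 1 - (1 : ℝ) / d := by
      rw [sub_nonneg, div_le_one (by positivity)]; exact_mod_cast hd
    refine le_trans (le_of_eq ?_) (Real.rpow_le_rpow (by positivity) h he)
    rw [← Real.rpow_natCast_mul (by positivity), ← Real.rpow_natCast]
    congr 1
    push_cast [Nat.cast_sub hd]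
    field_simp
  calc (edgeBdry u S : ℝ) ≤ ((K + k * (d * 2 ^ (d - 1)) : ℕ) : ℝ) * (s : ℝ) ^ (d - 1) := by
        exact_mod_cast hb
    _ ≤ _ := by gcongr

/-- The zonotope `∑ i, [0, a i • u i]`. -/
def zonotope {d k : ℕ} (u : Fin k → Fin d → ℤ) (a : Fin k → ℝ) : Set (Fin d → ℝ) :=
  Fintype.linearCombination ℝ (fun i => toReal' (u i)) '' Set.Icc 0 a

lemma convex_zonotope {d k : ℕ} (u : Fin k → Fin d → ℤ) (a : Fin k → ℝ) :
    Convex ℝ (zonotope u a) :=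
  (convex_Icc 0 a).linear_image _

lemma isCompact_zonotope {d k : ℕ} (u : Fin k → Fin d → ℤ) (a : Fin k → ℝ) :
    IsCompact (zonotope u a) :=
  isCompact_Icc.image (LinearMap.continuous_of_finiteDimensional _)

lemma zonotope_mono {d k : ℕ} (u : Fin k → Fin d → ℤ) {a b : Fin k → ℝ} (h : a ≤ b) :
    zonotope u a ⊆ zonotope u b :=
  Set.image_mono (Set.Icc_subset_Icc_right h)

lemma add_smul_mem_zonotope {d k : ℕ} (u : Fin k → Fin d → ℤ) {a : Fin k → ℝ} {j : Fin k}
    {r s : ℝ} (hr : 0 ≤ r) (hrs : r ≤ s) {x : Fin d → ℝ} (hx : x ∈ zonotope u a) :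
    x + r • toReal' (u j) ∈ zonotope u (a + Pi.single j s) := by
  obtain ⟨c, ⟨h0, hc⟩, rfl⟩ := hx
  refine ⟨c + Pi.single j r, ⟨add_nonneg h0 ?_, add_le_add hc ?_⟩, ?_⟩
  · simpa using hr
  · exact Pi.single_mono j hrs
  · rw [map_add, Fintype.linearCombination_apply_single]

lemma smul_zonotope {d k : ℕ} (u : Fin k → Fin d → ℤ) {t : ℝ} (ht : 0 < t) :
    t • zonotope u 1 = zonotope u (fun _ => t) := by
  unfold zonotope
  rw [← image_smul_set]
  congr 1
  ext c
  rw [Set.mem_smul_set_iff_inv_smul_mem₀ ht.ne']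
  simp only [Set.mem_Icc, Pi.le_def, Pi.smul_apply, smul_eq_mul, Pi.zero_apply, Pi.one_apply]
  refine and_congr (forall_congr' fun i => ?_) (forall_congr' fun i => ?_)
  · rw [mul_nonneg_iff_of_pos_left (by positivity)]
  · rw [inv_mul_le_iff₀ ht, mul_one]

/-- `toReal'` as a group homomorphism. -/
def toRealHom (d : ℕ) : (Fin d → ℤ) →+ (Fin d → ℝ) where
  toFun := toReal'
  map_zero' := by ext; simp [toReal']
  map_add' x y := by ext; simp [toReal']

lemma toReal'_injective (d : ℕ) : Function.Injective (toReal' (d := d)) := fun x y h => by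
  ext j
  exact Int.cast_injective (congrFun h j)

lemma toReal'_add_nsmul {d : ℕ} (v w : Fin d → ℤ) (m : ℕ) :
    toReal' (v + m • w) = toReal' v + (m : ℝ) • toReal' w := by
  ext j
  simp [toReal']

lemma convexHull_toReal'_sum_eq_zonotope {d k : ℕ} (u : Fin k → Fin d → ℤ) :
    convexHull ℝ (toReal' '' ((∑ i, ({0, u i} : Finset (Fin d → ℤ)) : Finset _) : Set _)) =
      zonotope u 1 := by
  have h : toReal' '' ((∑ i, ({0, u i} : Finset (Fin d → ℤ)) : Finset _) : Set (Fin d → ℤ)) =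
      ∑ i, ({0, toReal' (u i)} : Set (Fin d → ℝ)) := by
    rw [Finset.coe_sum]
    refine (Set.image_finsetSum (toRealHom d) _ _).trans (Finset.sum_congr rfl fun i _ => ?_)
    rw [Finset.coe_pair, Set.image_pair, map_zero]
    rfl
  rw [h, convexHull_sum]
  ext x
  rw [Set.mem_fintype_sum]
  simp only [convexHull_pair, segment_eq_image, smul_zero, zero_add]
  constructor
  · rintro ⟨g, hg, rfl⟩
    choose c hc hcg using hg
    exact ⟨c, ⟨fun i => (hc i).1, fun i => (hc i).2⟩, by
      rw [Fintype.linearCombination_apply]; exact Finset.sum_congr rfl fun i _ => hcg i⟩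
  · rintro ⟨c, hc, rfl⟩
    exact ⟨fun i => c i • toReal' (u i), fun i => ⟨c i, ⟨hc.1 i, hc.2 i⟩, rfl⟩,
      (Fintype.linearCombination_apply ..).symm⟩

/-- The lattice points of the zonotope `∑ i, [0, a i • u i]`. -/
noncomputable def latticePoints {d k : ℕ} (u : Fin k → Fin d → ℤ) (a : Fin k → ℝ) :
    Finset (Fin d → ℤ) :=
  Set.Finite.toFinset (s := toReal' ⁻¹' zonotope u a) <| by
    obtain ⟨r, hr⟩ := (isCompact_zonotope u a).isBounded.subset_closedBall 0
    refine (Set.finite_Icc (fun _ => -⌈r⌉) (fun _ => ⌈r⌉)).subset fun v hv => ?_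
    have h := hr hv
    rw [mem_closedBall_zero_iff] at h
    have h' : ∀ j, |(v j : ℝ)| ≤ r := fun j => (norm_le_pi_norm (toReal' v) j).trans h
    refine ⟨fun j => ?_, fun j => ?_⟩
    · have := (abs_le.1 (h' j)).1
      have h2 : -(⌈r⌉ : ℝ) ≤ v j := by linarith [Int.le_ceil r]
      exact_mod_cast h2
    · have := (abs_le.1 (h' j)).2
      have h2 : (v j : ℝ) ≤ ⌈r⌉ := by linarith [Int.le_ceil r]
      exact_mod_cast h2

lemma mem_latticePoints {d k : ℕ} {u : Fin k → Fin d → ℤ} {a : Fin k → ℝ} {v : Fin d → ℤ} :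
    v ∈ latticePoints u a ↔ toReal' v ∈ zonotope u a := by
  simp [latticePoints]

lemma add_mem_latticePoints {d k : ℕ} {u : Fin k → Fin d → ℤ} {a : Fin k → ℝ}
    {v w : Fin d → ℤ} (hv : v ∈ latticePoints u a) {m : ℕ} (hm : 1 ≤ m)
    (hvm : v + m • w ∈ latticePoints u a) : v + w ∈ latticePoints u a := by
  rw [mem_latticePoints] at *
  have hm' : (1 : ℝ) ≤ m := by exact_mod_cast hm
  have h := (convex_zonotope u a).add_smul_sub_mem hv hvm (t := (m : ℝ)⁻¹)
    ⟨by positivity, inv_le_one_of_one_le₀ hm'⟩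
  have h1 := toReal'_add_nsmul v w 1
  rw [one_smul, Nat.cast_one, one_smul] at h1
  rwa [toReal'_add_nsmul, add_sub_cancel_left, smul_smul, inv_mul_cancel₀ (by positivity),
    one_smul, ← h1] at h

/-- A discrete form of: the boundary of a dilate is at most the rate of growth of the volume. -/
lemma mul_edgeBdry_latticePoints_add_card_le {d k : ℕ} (u : Fin k → Fin d → ℤ)
    (hu : ∀ i, u i ≠ 0) (a : Fin k → ℝ) (s : ℕ) :
    s * edgeBdry u (latticePoints u a) + (latticePoints u a).card ≤
      (latticePoints u (fun i => a i + s)).card := by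
  set A := latticePoints u a with hA
  have key : ∀ J : Finset (Fin k), s * (∑ i ∈ J, (A.filter fun v => v + u i ∉ A).card) + A.card ≤
      (latticePoints u (a + ∑ i ∈ J, Pi.single i (s : ℝ))).card := by
    intro J
    induction J using Finset.induction_on with
    | empty => simp [hA]
    | insert j J hj ih =>
      have hle : a ≤ a + ∑ i ∈ J, Pi.single i (s : ℝ) :=
        le_add_of_nonneg_right (Finset.sum_nonneg fun i _ => by simp)
      have := mul_card_filter_add_notMem_le (hu j) (A := A) (s := s)
        (B := latticePoints u (a + ∑ i ∈ J, Pi.single i (s : ℝ)))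
        (C := latticePoints u (a + ∑ i ∈ J, Pi.single i (s : ℝ) + Pi.single j (s : ℝ)))
        (fun v hv m hm hvm => add_mem_latticePoints hv hm hvm)
        (fun v hv => mem_latticePoints.2 (zonotope_mono u hle (mem_latticePoints.1 hv)))
        (fun v hv r hr => by
          rw [mem_latticePoints, toReal'_add_nsmul]
          exact add_smul_mem_zonotope u (by positivity) (by exact_mod_cast hr)
            (mem_latticePoints.1 hv))
      rw [Finset.sum_insert hj, Finset.sum_insert hj, add_comm (Pi.single j _), ← add_assoc,
        mul_add]
      omega
  have h := key Finset.univ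
  rwa [Finset.univ_sum_single (fun _ => (s : ℝ))] at h

lemma tendsto_card_latticePoints_div_pow {d k : ℕ} (u : Fin k → Fin d → ℤ) :
    Tendsto (fun n : ℕ => ((latticePoints u (fun _ => (n : ℝ))).card : ℝ) / (n : ℝ) ^ d) atTop
      (𝓝 (volume.real (zonotope u 1))) := by
  have h := tendsto_card_div_pow_atTop_volume (zonotope u 1) (isCompact_zonotope u 1).isBounded
    (isCompact_zonotope u 1).measurableSet ((convex_zonotope u 1).addHaar_frontier volume)
  rw [Fintype.card_fin] at h
  refine h.congr' ?_
  filter_upwards [eventually_gt_atTop 0] with n hn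
  have hn' : (0 : ℝ) < n := by exact_mod_cast hn
  congr 2
  have himg : (latticePoints u fun _ => (n : ℝ) : Set (Fin d → ℤ)).ncard = _ :=
    Set.ncard_coe_finset _
  rw [← himg, ← Set.ncard_image_of_injective _ ((smul_right_injective _ (inv_ne_zero hn'.ne')).comp
    (toReal'_injective d)), ← Nat.card_coe_set_eq]
  congr 2
  ext x
  simp only [Set.mem_inter_iff, Set.mem_image, Function.comp_apply, Finset.mem_coe,
    mem_latticePoints, ← smul_zonotope u hn']
  constructor
  · rintro ⟨hx, y, hy, rfl⟩
    rw [SetLike.mem_coe, (Pi.basisFun ℝ (Fin d)).mem_span_iff_repr_mem ℤ] at hy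
    choose v hv using hy
    have hvy : toReal' v = y := by
      ext j
      simpa [toReal'] using hv j
    refine ⟨v, ?_, by rw [hvy]⟩
    rw [hvy, Set.mem_smul_set_iff_inv_smul_mem₀ hn'.ne']
    exact hx
  · rintro ⟨v, hv, rfl⟩
    rw [Set.mem_smul_set_iff_inv_smul_mem₀ hn'.ne'] at hv
    refine ⟨hv, Set.smul_mem_smul_set ?_⟩
    rw [SetLike.mem_coe, (Pi.basisFun ℝ (Fin d)).mem_span_iff_repr_mem ℤ]
    exact fun j => ⟨v j, by simp [toReal']⟩

lemma volume_zonotope_pos {d k : ℕ} (u : Fin k → Fin d → ℤ)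
    (hgen : AddSubgroup.closure (Set.range u) = ⊤) : 0 < volume.real (zonotope u 1) := by
  have hspan : Submodule.span ℝ (Set.range fun i => toReal' (u i)) = ⊤ := by
    have h : AddSubgroup.closure (Set.range u) ≤ (Submodule.span ℝ (Set.range fun i =>
        toReal' (u i))).toAddSubgroup.comap (toRealHom d) := by
      rw [AddSubgroup.closure_le]
      rintro _ ⟨i, rfl⟩
      exact Submodule.subset_span ⟨i, rfl⟩
    rw [hgen, top_le_iff] at h
    rw [← top_le_iff, ← (Pi.basisFun ℝ (Fin d)).span_eq, Submodule.span_le]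
    rintro _ ⟨j, rfl⟩
    have hj : Pi.single j 1 ∈ (⊤ : AddSubgroup (Fin d → ℤ)) := trivial
    rw [← h] at hj
    have he : Pi.basisFun ℝ (Fin d) j = toReal' (Pi.single j 1) := by
      ext l
      by_cases hl : l = j <;> simp [toReal', hl]
    rw [he]
    exact hj
  have h0 : (0 : Fin d → ℝ) ∈ zonotope u 1 := ⟨0, ⟨le_rfl, zero_le_one⟩, map_zero _⟩
  have hne : (interior (zonotope u 1)).Nonempty := by
    rw [(convex_zonotope u 1).interior_nonempty_iff_affineSpan_eq_top,
      AffineSubspace.affineSpan_eq_top_iff_vectorSpan_eq_top_of_nonempty ℝ _ _ ⟨0, h0⟩,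
      ← top_le_iff, ← hspan, Submodule.span_le]
    rintro _ ⟨i, rfl⟩
    rw [vectorSpan_eq_span_vsub_set_right ℝ h0]
    refine Submodule.subset_span ⟨toReal' (u i), ⟨Pi.single i 1, ⟨by simp, ?_⟩, ?_⟩, by simp⟩
    · intro l
      by_cases hl : l = i <;> simp [hl]
    · rw [Fintype.linearCombination_apply_single, one_smul]
  exact ENNReal.toReal_pos (Measure.measure_pos_of_nonempty_interior _ hne).ne'
    (isCompact_zonotope u 1).measure_lt_top.ne

lemma exists_le_lt_succ_of_tendsto_atTop {a : ℕ → ℕ} (ha : Tendsto a atTop atTop) {s₀ n : ℕ}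
    (h : a s₀ ≤ n) : ∃ s, s₀ ≤ s ∧ a s ≤ n ∧ n < a (s + 1) := by
  classical
  have hex : ∃ s, s₀ ≤ s ∧ n < a s :=
    ((eventually_ge_atTop s₀).and (ha.eventually_gt_atTop n)).exists
  obtain ⟨h1, h2⟩ := Nat.find_spec hex
  set t := Nat.find hex
  have hne : t ≠ s₀ := fun h0 => by rw [h0] at h2; omega
  have hmin := Nat.find_min hex (m := t - 1) (by omega)
  refine ⟨t - 1, by omega, ?_, by rwa [Nat.sub_add_cancel (by omega)]⟩
  by_contra hlt
  exact hmin ⟨by omega, by omega⟩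

lemma exists_succ_pow_lt_mul_pow (m : ℕ) {δ : ℝ} (hδ : 0 < δ) :
    ∃ q : ℕ, 0 < q ∧ ((q : ℝ) + 1) ^ m < (1 + δ) * (q : ℝ) ^ m := by
  have h : Tendsto (fun q : ℕ => (((q : ℝ) + 1) / q) ^ m) atTop (𝓝 (1 ^ m)) := by
    refine Tendsto.pow ?_ m
    have := (tendsto_one_div_atTop_nhds_zero_nat (𝕜 := ℝ)).const_add 1
    rw [add_zero] at this
    refine this.congr' ?_
    filter_upwards [eventually_gt_atTop 0] with q hq
    have : (q : ℝ) ≠ 0 := by positivity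
    field_simp
  rw [one_pow] at h
  obtain ⟨q, hq, hq0⟩ := ((h.eventually_lt_const (by linarith : (1 : ℝ) < 1 + δ)).and
    (eventually_gt_atTop 0)).exists
  refine ⟨q, hq0, ?_⟩
  rwa [div_pow, div_lt_iff₀ (by positivity)] at hq

lemma exists_edgeBdry_le_of_two_le {d k : ℕ} (hd : 2 ≤ d) (u : Fin k → Fin d → ℤ)
    (hu : ∀ i, u i ≠ 0) {V : ℝ} (hV : 0 < V)
    (hlim : Tendsto (fun n : ℕ => ((latticePoints u (fun _ => (n : ℝ))).card : ℝ) / (n : ℝ) ^ d)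
      atTop (𝓝 V)) {δ : ℝ} (hδ : 0 < δ) :
    ∃ n₀ : ℕ, ∀ n : ℕ, n₀ ≤ n → ∃ S : Finset (Fin d → ℤ), S.card = n ∧
      (edgeBdry u S : ℝ) ≤ (1 + δ) * d * V ^ ((1 : ℝ) / d) * (n : ℝ) ^ (1 - (1 : ℝ) / d) := by
  obtain ⟨C, hC, hsmall⟩ := exists_edgeBdry_le_mul_rpow (by omega : 1 ≤ d) u
  obtain ⟨q, hq, hqδ⟩ := exists_succ_pow_lt_mul_pow (d - 1) hδ
  set α : ℝ := 1 - (1 : ℝ) / d with hα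
  have hdR : (2 : ℝ) ≤ d := by exact_mod_cast hd
  have hα0 : 0 < α := by
    rw [hα, sub_pos, div_lt_one (by positivity)]; linarith
  have hpowα : ∀ x : ℝ, 0 ≤ x → (x ^ d) ^ α = x ^ (d - 1) := fun x hx => by
    rw [← Real.rpow_natCast_mul hx, ← Real.rpow_natCast, hα]
    congr 1
    push_cast [Nat.cast_sub (by omega : 1 ≤ d)]
    field_simp
  set N : ℕ → ℕ := fun n => (latticePoints u (fun _ => (n : ℝ))).card with hN
  have hNmul : ∀ p : ℕ, 0 < p →
      Tendsto (fun s : ℕ => (N (p * s) : ℝ) / (s : ℝ) ^ d) atTop (𝓝 (V * (p : ℝ) ^ d)) := by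
    intro p hp
    refine ((hlim.comp (tendsto_id.const_mul_atTop' hp)).mul_const ((p : ℝ) ^ d)).congr fun s => ?_
    have hp' : ((p : ℝ) ^ d) ≠ 0 := by positivity
    simp only [Function.comp_apply, id, hN]
    rw [Nat.cast_mul, mul_pow, div_mul_eq_mul_div, mul_comm ((p : ℝ) ^ d),
      mul_div_mul_right _ _ hp']
  have hNsucc : Tendsto (fun s : ℕ => (N (q * (s + 1)) : ℝ) / (s : ℝ) ^ d) atTop
      (𝓝 (V * (q : ℝ) ^ d)) := by
    have h1 := (hNmul q hq).comp (tendsto_add_atTop_nat 1)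
    have h2 : Tendsto (fun s : ℕ => (1 + 1 / (s : ℝ)) ^ d) atTop (𝓝 ((1 + 0) ^ d)) :=
      ((tendsto_one_div_atTop_nhds_zero_nat (𝕜 := ℝ)).const_add 1).pow d
    have h3 := h1.mul h2
    rw [add_zero, one_pow, mul_one] at h3
    refine h3.congr' ?_
    filter_upwards [eventually_gt_atTop 0] with s hs
    have hs' : (s : ℝ) ≠ 0 := by positivity
    have hs'' : (s : ℝ) + 1 ≠ 0 := by positivity
    simp only [Function.comp_apply]
    rw [show 1 + 1 / (s : ℝ) = (s + 1) / s by field_simp, div_pow, Nat.cast_add_one]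
    field_simp
  have hNtop : Tendsto (fun s => N (q * s)) atTop atTop := by
    rw [← tendsto_natCast_atTop_iff (R := ℝ)]
    have h1 : Tendsto (fun s : ℕ => (s : ℝ) ^ d) atTop atTop :=
      (tendsto_pow_atTop (by omega)).comp tendsto_natCast_atTop_atTop
    refine ((hNmul q hq).pos_mul_atTop (by positivity) h1).congr' ?_
    filter_upwards [eventually_gt_atTop 0] with s hs
    exact div_mul_cancel₀ _ (by positivity)
  have hlt : ∀ᶠ s : ℕ in atTop,
      ((N ((q + 1) * s) : ℝ) / (s : ℝ) ^ d - (N (q * s) : ℝ) / (s : ℝ) ^ d) +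
        C * |(N (q * (s + 1)) : ℝ) / (s : ℝ) ^ d - (N (q * s) : ℝ) / (s : ℝ) ^ d| ^ α <
      (1 + δ) * d * V ^ ((1 : ℝ) / d) * ((N (q * s) : ℝ) / (s : ℝ) ^ d) ^ α := by
    refine Tendsto.eventually_lt
      (((hNmul (q + 1) (by omega)).sub (hNmul q hq)).add
        (((hNsucc.sub (hNmul q hq)).abs.rpow_const (Or.inr hα0.le)).const_mul C))
      (((hNmul q hq).rpow_const (Or.inr hα0.le)).const_mul _) ?_
    rw [sub_self, abs_zero, Real.zero_rpow hα0.ne', mul_zero, add_zero,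
      Real.mul_rpow hV.le (by positivity), hpowα _ (by positivity), mul_assoc ((1 + δ) * d),
      ← mul_assoc (V ^ _), ← Real.rpow_add hV, hα, add_sub_cancel, Real.rpow_one]
    have h1 : ((q : ℝ) + 1) ^ d ≤ (q : ℝ) ^ d + d * ((q : ℝ) + 1) ^ (d - 1) := by
      exact_mod_cast succ_pow_le_add q d
    have h2 : (d : ℝ) * ((q : ℝ) + 1) ^ (d - 1) < d * ((1 + δ) * (q : ℝ) ^ (d - 1)) := by gcongr
    push_cast
    calc V * ((q : ℝ) + 1) ^ d - V * (q : ℝ) ^ d = V * (((q : ℝ) + 1) ^ d - (q : ℝ) ^ d) := by ring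
      _ < V * (d * ((1 + δ) * (q : ℝ) ^ (d - 1))) := by gcongr; linarith
      _ = _ := by ring
  obtain ⟨s₀, hs₀⟩ := eventually_atTop.1 hlt
  refine ⟨N (q * (s₀ + 1)), fun n hn => ?_⟩
  obtain ⟨s, hs, hsn, hns⟩ := exists_le_lt_succ_of_tendsto_atTop hNtop hn
  obtain ⟨R, hR, hRb⟩ := hsmall (n - N (q * s))
  obtain ⟨S, hS, hSb⟩ := exists_card_add_edgeBdry_le (by omega) u
    (latticePoints u (fun _ => ((q * s : ℕ) : ℝ))) R
  refine ⟨S, by rw [hS, hR]; exact Nat.add_sub_cancel' hsn, ?_⟩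
  have hs0 : (0 : ℝ) < s := by exact_mod_cast (by omega : 0 < s)
  have hsd : (0 : ℝ) < (s : ℝ) ^ d := by positivity
  have hmain := mul_edgeBdry_latticePoints_add_card_le u hu (fun _ => ((q * s : ℕ) : ℝ)) s
  have hcast : (fun _ : Fin k => ((q * s : ℕ) : ℝ) + s) = fun _ => (((q + 1) * s : ℕ) : ℝ) := by
    ext; push_cast; ring
  rw [hcast] at hmain
  have hmainR : (s : ℝ) * edgeBdry u (latticePoints u (fun _ => ((q * s : ℕ) : ℝ))) + N (q * s) ≤
      N ((q + 1) * s) := by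
    exact_mod_cast hmain
  have hb1 : (edgeBdry u (latticePoints u (fun _ => ((q * s : ℕ) : ℝ))) : ℝ) ≤
      (s : ℝ) ^ (d - 1) * ((N ((q + 1) * s) : ℝ) / (s : ℝ) ^ d - (N (q * s) : ℝ) / (s : ℝ) ^ d) := by
    rw [← sub_div, ← mul_pow_sub_one (by omega : d ≠ 0) (s : ℝ), mul_div_assoc',
      mul_comm (s : ℝ) (_ ^ _), mul_div_mul_left _ _ (by positivity), le_div_iff₀ hs0]
    linarith
  have hb2 : (edgeBdry u R : ℝ) ≤ (s : ℝ) ^ (d - 1) *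
      (C * |(N (q * (s + 1)) : ℝ) / (s : ℝ) ^ d - (N (q * s) : ℝ) / (s : ℝ) ^ d| ^ α) := by
    have hnR : ((n - N (q * s) : ℕ) : ℝ) ≤ (N (q * (s + 1)) : ℝ) - N (q * s) := by
      rw [Nat.cast_sub hsn]
      have : (n : ℝ) ≤ N (q * (s + 1)) := by exact_mod_cast hns.le
      linarith
    refine hRb.trans ?_
    rw [← hpowα s hs0.le, mul_left_comm, ← Real.mul_rpow hsd.le (abs_nonneg _)]
    gcongr
    rw [← sub_div]
    calc ((n - N (q * s) : ℕ) : ℝ) ≤ (N (q * (s + 1)) : ℝ) - N (q * s) := hnR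
      _ = (s : ℝ) ^ d * (((N (q * (s + 1)) : ℝ) - N (q * s)) / (s : ℝ) ^ d) := by field_simp
      _ ≤ _ := by gcongr; exact le_abs_self _
  calc (edgeBdry u S : ℝ)
      ≤ edgeBdry u (latticePoints u (fun _ => ((q * s : ℕ) : ℝ))) + edgeBdry u R := by
        exact_mod_cast hSb
    _ ≤ (s : ℝ) ^ (d - 1) *
        (((N ((q + 1) * s) : ℝ) / (s : ℝ) ^ d - (N (q * s) : ℝ) / (s : ℝ) ^ d) +
        C * |(N (q * (s + 1)) : ℝ) / (s : ℝ) ^ d - (N (q * s) : ℝ) / (s : ℝ) ^ d| ^ α) := by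
        rw [mul_add]; exact add_le_add hb1 hb2
    _ ≤ (s : ℝ) ^ (d - 1) *
        ((1 + δ) * d * V ^ ((1 : ℝ) / d) * ((N (q * s) : ℝ) / (s : ℝ) ^ d) ^ α) :=
        mul_le_mul_of_nonneg_left (hs₀ s (by omega)).le (by positivity)
    _ = (1 + δ) * d * V ^ ((1 : ℝ) / d) * (N (q * s) : ℝ) ^ α := by
        rw [← hpowα s hs0.le, mul_left_comm, ← Real.mul_rpow hsd.le (by positivity),
          mul_div_cancel₀ _ hsd.ne']
    _ ≤ _ := by gcongr

lemma sum_natAbs_le_volume_zonotope {k : ℕ} (u : Fin k → Fin 1 → ℤ) :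
    ((∑ i, ∑ j, (u i j).natAbs : ℕ) : ℝ) ≤ volume.real (zonotope u 1) := by
  set lo : Fin k → ℝ := fun i => if u i 0 < 0 then 1 else 0 with hlo
  set L := Fintype.linearCombination ℝ (fun i => toReal' (u i)) with hL
  have hconv : Convex ℝ ((LinearMap.pi fun _ : Fin 1 => (LinearMap.id : ℝ →ₗ[ℝ] ℝ)) ⁻¹'
      zonotope u 1) := (convex_zonotope u 1).linear_preimage _
  have hmem : ∀ c ∈ Set.Icc (0 : Fin k → ℝ) 1, L c ∈ zonotope u 1 :=
    fun c hc => Set.mem_image_of_mem _ hc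
  have hconst : ∀ x : Fin 1 → ℝ,
      (LinearMap.pi fun _ : Fin 1 => (LinearMap.id : ℝ →ₗ[ℝ] ℝ)) (x 0) = x := fun x => by
    ext j; simp [Subsingleton.elim j 0]
  have hlomem : lo ∈ Set.Icc (0 : Fin k → ℝ) 1 := by
    refine ⟨fun i => ?_, fun i => ?_⟩ <;> by_cases h : u i 0 < 0 <;> simp [hlo, h]
  have himem : 1 - lo ∈ Set.Icc (0 : Fin k → ℝ) 1 :=
    ⟨sub_nonneg.2 hlomem.2, sub_le_self _ hlomem.1⟩
  have hsub : Set.Icc (L lo) (L (1 - lo)) ⊆ zonotope u 1 := by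
    intro x hx
    have h := hconv.ordConnected.out (x := L lo 0) (y := L (1 - lo) 0)
      (by rw [Set.mem_preimage, hconst]; exact hmem _ hlomem)
      (by rw [Set.mem_preimage, hconst]; exact hmem _ himem) (a := x 0) ⟨hx.1 0, hx.2 0⟩
    rwa [Set.mem_preimage, hconst] at h
  have hdiff : L (1 - lo) 0 - L lo 0 = ((∑ i, ∑ j, (u i j).natAbs : ℕ) : ℝ) := by
    simp only [hL, Fintype.linearCombination_apply, Finset.sum_apply, Pi.smul_apply,
      ← Finset.sum_sub_distrib, Finset.univ_unique, Finset.sum_singleton, Nat.cast_sum]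
    refine Finset.sum_congr rfl fun i _ => ?_
    rw [Nat.cast_natAbs, Int.cast_abs]
    by_cases h : u i 0 < 0
    · have h' : (u i 0 : ℝ) < 0 := by exact_mod_cast h
      simp [hlo, h, toReal', abs_of_neg h']
    · have h' : (0 : ℝ) ≤ u i 0 := by exact_mod_cast not_lt.1 h
      simp [hlo, h, toReal', abs_of_nonneg h']
  rw [← hdiff]
  calc L (1 - lo) 0 - L lo 0 ≤ max (L (1 - lo) 0 - L lo 0) 0 := le_max_left _ _
    _ = volume.real (Set.Icc (L lo) (L (1 - lo))) := by
        rw [measureReal_def, Real.volume_Icc_pi]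
        simp [ENNReal.toReal_ofReal']
    _ ≤ _ := measureReal_mono hsub (isCompact_zonotope u 1).measure_lt_top.ne

theorem edge_iso_upper_bound (d k : ℕ) (hd : 1 ≤ d)
    (u : Fin k → (Fin d → ℤ)) (hu : ∀ i, u i ≠ 0)
    (hgen : AddSubgroup.closure (Set.range u) = ⊤)
    (Z0 : Finset (Fin d → ℤ))
    (hZ0 : Z0 = ∑ i, ({0, u i} : Finset (Fin d → ℤ)))
    (Z : Set (Fin d → ℝ))
    (hZ : Z = convexHull ℝ (toReal' '' (Z0 : Set (Fin d → ℤ))))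
    (δ : ℝ) (hδ : 0 < δ) :
    ∃ n₀ : ℕ, ∀ n : ℕ, n₀ ≤ n → ∃ S : Finset (Fin d → ℤ), S.card = n ∧
      (edgeBdry u S : ℝ)
        ≤ (1 + δ) * d * (volume Z).toReal ^ ((1 : ℝ) / d) * (n : ℝ) ^ (1 - (1 : ℝ) / d) := by
  rw [hZ0, convexHull_toReal'_sum_eq_zonotope] at hZ
  subst hZ
  rw [← measureReal_def]
  rcases hd.eq_or_lt with rfl | hd2
  · refine ⟨0, fun n _ => ⟨discreteCube 1 n, by rw [card_discreteCube, pow_one], ?_⟩⟩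
    have h1 : (edgeBdry u (discreteCube 1 n) : ℝ) ≤ ((∑ i, ∑ j, (u i j).natAbs : ℕ) : ℝ) := by
      have := edgeBdry_discreteCube_le u n
      rw [Nat.sub_self, pow_zero, mul_one] at this
      exact_mod_cast this
    have h2 := h1.trans (sum_natAbs_le_volume_zonotope u)
    have h3 : 0 ≤ volume.real (zonotope u 1) := measureReal_nonneg
    norm_num
    nlinarith
  · exact exists_edgeBdry_le_of_two_le hd2 u hu (volume_zonotope_pos u hgen)
      (tendsto_card_latticePoints_div_pow u) hδ
end
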